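/- arXiv:2501.09189 — 2 statements merged into one kernel-verified Lean document; each statement's English description precedes it below -/
import Mathlib

section
/- There exists an absolute constant C ≥ 1 such that for every dimension d ≥ 2, every ε ∈ (0,1), every integer k₂ ≥ 2, and every unit vector v ∈ ℝ^d, there is a finite partition 𝒞 of ℝ^d each of whose members is of the form {x ∈ ℝ^d : a ≤ v·x < b} with a < b taken from the set {−∞, +∞} ∪ {j·ε : j ∈ ℤ, |j| ≤ k₁}, where k₁ := ⌈2√(log(2/ε))/ε⌉, with the following property: for every unit vector v' ∈ ℝ^d, the function x ↦ 1_{sign(v·x) ≠ sign(v'·x)} has (C·∠(v,v')·(log(k₂+2))^{3/2}/k₂^{1/4} + 10ε, C·d^{10·k₂})-sandwiching degree at most k₂ in L1 norm under N(0,I_d) with respect to 𝒞. -/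
open MeasureTheory ProbabilityTheory Real
open scoped ENNReal

noncomputable section

/-- `sgn t = 1` if `t ≥ 0` and `-1` otherwise. -/
def sgn (t : ℝ) : ℝ := if 0 ≤ t then 1 else -1

/-- Euclidean dot product on `ℝ^d`. -/
def dotp {d : ℕ} (v w : Fin d → ℝ) : ℝ := ∑ i, v i * w i

/-- `v` is a unit vector. -/
def IsUnitVec {d : ℕ} (v : Fin d → ℝ) : Prop := dotp v v = 1

/-- The standard Gaussian measure `N(0, I_d)` on `ℝ^d`. -/
def stdGaussian (d : ℕ) : Measure (Fin d → ℝ) := Measure.pi fun _ => gaussianReal 0 1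

/-- The angle `∠(v, v') = arccos (v ⬝ v')` between unit vectors. -/
def angleOf {d : ℕ} (v w : Fin d → ℝ) : ℝ := Real.arccos (dotp v w)

/-- `f` has `(ν, B)`-sandwiching degree at most `k` in `L1` norm under `N(0, I_d)` with
respect to the partition `𝒞`. -/
def SandwichL1 {d : ℕ} (𝒞 : Finset (Set (Fin d → ℝ))) (f : (Fin d → ℝ) → ℝ)
    (k : ℕ) (ν B : ℝ) : Prop :=
  ∃ pd pu : Set (Fin d → ℝ) → MvPolynomial (Fin d) ℝ,
    (∀ A ∈ 𝒞, (pd A).totalDegree ≤ k ∧ (pu A).totalDegree ≤ k ∧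
      (∀ m, |(pd A).coeff m| ≤ B) ∧ (∀ m, |(pu A).coeff m| ≤ B)) ∧
    (∀ x, (∑ A ∈ 𝒞, Set.indicator A (fun y => MvPolynomial.eval y (pd A)) x) ≤ f x ∧
      f x ≤ ∑ A ∈ 𝒞, Set.indicator A (fun y => MvPolynomial.eval y (pu A)) x) ∧
    (∫ x, (∑ A ∈ 𝒞, Set.indicator A
        (fun y => MvPolynomial.eval y (pu A) - MvPolynomial.eval y (pd A)) x)
      ∂(stdGaussian d)) ≤ ν

section PartOne
open Polynomial

lemma bezout_nodes (Z : List ℝ) : ∀ R : List ℝ, (∀ z ∈ Z, ∀ r ∈ R, z < r) →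
    ∃ h g : ℝ[X], (R.map (fun r => C r - X)).prod * h + (Z.map (fun z => X - C z)).prod * g = 1
      ∧ h.degree < ((Z.length : ℕ) : WithBot ℕ)
      ∧ (∀ s, (∀ z ∈ Z, z ≤ s) → 0 ≤ h.eval s) ∧ (∀ s, (∀ r ∈ R, s ≤ r) → 0 ≤ g.eval s) := by
  induction Z with
  | nil =>
    intro R _
    exact ⟨0, 1, by simp, by simp, by simp, by simp⟩
  | cons z Z0 ihZ =>
    intro R
    induction R with
    | nil =>
      intro _
      refine ⟨1, 0, by simp, ?_, by simp, by simp⟩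
      rw [degree_one]
      simp only [List.length_cons]
      exact_mod_cast Nat.succ_pos _
    | cons r R0 ihR =>
      intro hlt
      obtain ⟨h1, g1, e1, d1, p1, n1⟩ := ihR (fun z hz r' hr' => hlt z hz r' (List.mem_cons_of_mem _ hr'))
      obtain ⟨h2, g2, e2, d2, p2, n2⟩ := ihZ (r :: R0)
        (fun z' hz r' hr' => hlt z' (List.mem_cons_of_mem _ hz) r' hr')
      have hzr : z < r := hlt z (by simp) r (by simp)
      have hne : r - z ≠ 0 := by linarith
      have hpos : 0 < (r - z)⁻¹ := inv_pos.mpr (by linarith)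
      refine ⟨C (r - z)⁻¹ * (h1 + (X - C z) * h2), C (r - z)⁻¹ * ((C r - X) * g1 + g2), ?_, ?_, ?_, ?_⟩
      · have key : C (r - z)⁻¹ * ((C r - X) + (X - C z)) = (1 : ℝ[X]) := by
          rw [show (C r - X) + (X - C z) = (C (r - z) : ℝ[X]) by simp, ← C_mul,
            inv_mul_cancel₀ hne, C_1]
        simp only [List.map_cons, List.prod_cons] at e1 e2 ⊢
        calc _ = C (r - z)⁻¹ * ((C r - X) * ((R0.map (fun r => C r - X)).prod * h1 +
                  (X - C z) * (Z0.map (fun z => X - C z)).prod * g1) + (X - C z) *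
                  ((C r - X) * (R0.map (fun r => C r - X)).prod * h2 +
                  (Z0.map (fun z => X - C z)).prod * g2)) := by ring
          _ = 1 := by rw [e1, e2, mul_one, mul_one, key]
      · rw [degree_C_mul (by positivity)]
        refine (degree_add_le _ _).trans_lt (max_lt d1 ?_)
        rw [degree_mul, degree_X_sub_C, List.length_cons]
        by_cases h20 : h2 = 0
        · subst h20; rw [degree_zero, WithBot.add_bot]; exact WithBot.bot_lt_coe _
        · rw [degree_eq_natDegree h20] at d2 ⊢
          have : h2.natDegree < Z0.length := by exact_mod_cast d2
          have : 1 + h2.natDegree < Z0.length + 1 := by omega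
          exact_mod_cast this
      · intro s hs
        have a1 := p1 s hs
        have a2 := p2 s (fun z' hz => hs z' (List.mem_cons_of_mem _ hz))
        have a3 : 0 ≤ s - z := sub_nonneg.mpr (hs z (by simp))
        simp only [eval_mul, eval_C, eval_add, eval_sub, eval_X]
        positivity
      · intro s hs
        have a1 := n1 s (fun z' hz => hs z' (List.mem_cons_of_mem _ hz))
        have a2 := n2 s hs
        have a3 : 0 ≤ r - s := sub_nonneg.mpr (hs r (by simp))
        simp only [eval_mul, eval_C, eval_add, eval_sub, eval_X]
        positivity

lemma prodR_natDegree (R : List ℝ) : (R.map (fun r => C r - X)).prod.natDegree = R.length := by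
  induction R with
  | nil => simp
  | cons r R ih =>
    have h1 : (C r - X : ℝ[X]) = - (X - C r) := by ring
    have h0 : (C r - X : ℝ[X]) ≠ 0 := by rw [h1]; exact neg_ne_zero.mpr (X_sub_C_ne_zero r)
    have hR : (R.map (fun r => C r - X)).prod ≠ (0 : ℝ[X]) := by
      apply List.prod_ne_zero
      simp only [List.mem_map, not_exists, not_and]
      intro x _ hx
      have h1 : (C x - X : ℝ[X]) = - (X - C x) := by ring
      rw [h1] at hx
      exact X_sub_C_ne_zero x (neg_eq_zero.mp hx)
    rw [List.map_cons, List.prod_cons, natDegree_mul h0 hR, ih, h1, natDegree_neg, natDegree_X_sub_C,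
      List.length_cons]
    omega

lemma prodL_natDegree (R : List ℝ) : (R.map (fun r => X - C r)).prod.natDegree = R.length := by
  induction R with
  | nil => simp
  | cons r R ih =>
    have h0 : (X - C r : ℝ[X]) ≠ 0 := X_sub_C_ne_zero r
    have hR : (R.map (fun r => X - C r)).prod ≠ (0 : ℝ[X]) := by
      apply List.prod_ne_zero
      simp only [List.mem_map, not_exists, not_and]
      intro x _ hx
      exact X_sub_C_ne_zero x hx
    rw [List.map_cons, List.prod_cons, natDegree_mul h0 hR, ih, natDegree_X_sub_C,
      List.length_cons]
    omega

lemma sandwich_lists (l r : List ℝ) (hl : ∀ z ∈ l, z < 0) (hr : ∀ z ∈ r, 0 < z) :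
    ∃ pu pd : ℝ[X], pu.natDegree ≤ 2 * (l.length + r.length) ∧
      pd.natDegree ≤ 2 * (l.length + r.length) ∧
      (∀ s, s ≤ 0 → 1 ≤ pu.eval s) ∧ (∀ s, 0 ≤ s → 0 ≤ pu.eval s) ∧
      (∀ s, s ≤ 0 → pd.eval s ≤ 1) ∧ (∀ s, 0 ≤ s → pd.eval s ≤ 0) ∧
      ∃ c : ℝ, pu - pd = C c * ((l.map (fun z => X - C z)).prod * (r.map (fun z => C z - X)).prod) ^ 2
        ∧ (pu - pd).eval 0 = 1 := by
  set A : ℝ[X] := (l.map (fun z => X - C z)).prod with hA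
  set B : ℝ[X] := (r.map (fun z => C z - X)).prod with hB
  have dA : A.natDegree = l.length := prodL_natDegree l
  have dB : B.natDegree = r.length := prodR_natDegree r
  obtain ⟨h, g, e, d, p, n⟩ := bezout_nodes (0 :: (l ++ l)) (r ++ r) (by
    intro z hz x hx
    have hx' : 0 < x := hr x (by simpa using hx)
    rcases List.mem_cons.mp hz with rfl | hz
    · exact hx'
    · exact (hl z (by simpa using hz)).trans hx')
  obtain ⟨h', g', e', d', p', n'⟩ := bezout_nodes (l ++ l) (0 :: (r ++ r)) (by
    intro z hz x hx
    have hz' : z < 0 := hl z (by simpa using hz)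
    rcases List.mem_cons.mp hx with rfl | hx
    · exact hz'
    · exact hz'.trans (hr x (by simpa using hx)))
  simp only [List.map_cons, List.map_append, List.prod_cons, List.prod_append, C_0, sub_zero, zero_sub] at e e'
  rw [← hA, ← hB] at e e'
  have hcop : IsCoprime (A * A) (B * B) := ⟨X * g, h, by rw [← e]; ring⟩
  have hdeg1 : (B * B * h).natDegree ≤ 2 * (l.length + r.length) := by
    have h1 : h.natDegree ≤ 2 * l.length := by
      rw [natDegree_le_iff_degree_le]
      have : ((0 :: (l ++ l)).length) = 2 * l.length + 1 := by simp; ring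
      rw [this] at d
      exact Order.lt_succ_iff.mp d
    have := natDegree_mul_le (p := B * B) (q := h)
    have := natDegree_mul_le (p := B) (q := B)
    omega
  have hdeg2 : (-X * (B * B) * h').natDegree ≤ 2 * (l.length + r.length) := by
    by_cases h0 : h' = 0
    · rw [h0, mul_zero, natDegree_zero]; omega
    rw [degree_eq_natDegree h0] at d'
    have h1 : h'.natDegree < 2 * l.length := by
      have : ((l ++ l).length) = 2 * l.length := by simp; ring
      rw [this] at d'
      exact_mod_cast d'
    have := natDegree_mul_le (p := -X * (B * B)) (q := h')
    have := natDegree_mul_le (p := -X) (q := B * B)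
    have := natDegree_mul_le (p := B) (q := B)
    have : (-X : ℝ[X]).natDegree = 1 := by rw [natDegree_neg, natDegree_X]
    omega
  have ev0 : (B * B * h - -X * (B * B) * h').eval 0 = 1 := by
    have := congrArg (eval 0) e
    simpa using this
  refine ⟨B * B * h, -X * (B * B) * h', hdeg1, hdeg2, ?_, ?_, ?_, ?_, ?_⟩
  · intro s hs
    have hg := n s (fun x hx => hs.trans (hr x (by simpa using hx)).le)
    have := congrArg (eval s) e
    simp only [eval_add, eval_mul, eval_X, eval_one] at this ⊢
    nlinarith [mul_nonneg (mul_nonneg (neg_nonneg.mpr hs) (mul_self_nonneg (eval s A))) hg]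
  · intro s hs
    have hg := p s (by
      intro z hz
      rcases List.mem_cons.mp hz with rfl | hz
      · exact hs
      · exact (hl z (by simpa using hz)).le.trans hs)
    simp only [eval_mul]
    exact mul_nonneg (mul_self_nonneg _) hg
  · intro s hs
    have hg := n' s (by
      intro z hz
      rcases List.mem_cons.mp hz with rfl | hz
      · exact hs
      · exact hs.trans (hr z (by simpa using hz)).le)
    have := congrArg (eval s) e'
    simp only [eval_add, eval_mul, eval_X, eval_one] at this ⊢
    nlinarith [mul_nonneg (mul_self_nonneg (eval s A)) hg]
  · intro s hs
    have hg := p' s (fun x hx => (hl x (by simpa using hx)).le.trans hs)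
    simp only [eval_mul, eval_neg, eval_X]
    nlinarith [mul_nonneg (mul_nonneg hs (mul_self_nonneg (eval s B))) hg]
  · have hdA : A * A ∣ B * B * h - -X * (B * B) * h' := by
      have : B * B * h - -X * (B * B) * h' = A * A * (g' - X * g) := by
        linear_combination e - e'
      rw [this]; exact dvd_mul_right _ _
    have hdB : B * B ∣ B * B * h - -X * (B * B) * h' := ⟨h + X * h', by ring⟩
    obtain ⟨w, hw⟩ := hcop.mul_dvd hdA hdB
    have hD0 : B * B * h - -X * (B * B) * h' ≠ 0 := by
      intro h0; rw [h0] at ev0; simp at ev0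
    have hAB0 : A * A * (B * B) ≠ 0 := by
      intro h0; rw [h0, zero_mul] at hw; exact hD0 hw
    have hw0 : w ≠ 0 := by
      intro h0; rw [h0, mul_zero] at hw; exact hD0 hw
    have hA0 : A ≠ 0 := by rintro h0; simp [h0] at hAB0
    have hB0 : B ≠ 0 := by rintro h0; simp [h0] at hAB0
    have hdw : w.natDegree = 0 := by
      have h1 := natDegree_mul hAB0 hw0
      rw [← hw, natDegree_mul (mul_ne_zero hA0 hA0) (mul_ne_zero hB0 hB0), natDegree_mul hA0 hA0,
        natDegree_mul hB0 hB0] at h1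
      have h2 := natDegree_sub_le_of_le hdeg1 hdeg2
      rw [max_self] at h2
      omega
    rw [eq_C_of_natDegree_eq_zero hdw] at hw
    exact ⟨w.coeff 0, by rw [hw]; ring, ev0⟩

lemma sandwich_splits (Q : ℝ[X]) (hQ : Q.Splits) (h0 : Q.eval 0 = 1) :
    ∃ pu pd : ℝ[X], pu.natDegree ≤ 2 * Q.natDegree ∧ pd.natDegree ≤ 2 * Q.natDegree ∧
      (∀ s, s ≤ 0 → 1 ≤ pu.eval s) ∧ (∀ s, 0 ≤ s → 0 ≤ pu.eval s) ∧
      (∀ s, s ≤ 0 → pd.eval s ≤ 1) ∧ (∀ s, 0 ≤ s → pd.eval s ≤ 0) ∧ pu - pd = Q ^ 2 := by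
  classical
  have hne : Q ≠ 0 := by rintro rfl; simp at h0
  set M := Q.roots with hM
  have hroot : ∀ z ∈ M, z ≠ 0 := by
    rintro z hz rfl
    have := (mem_roots hne).mp hz
    rw [IsRoot, h0] at this; exact one_ne_zero this
  set l := (M.filter (· < 0)).toList
  set r := (M.filter (fun z => ¬ z < 0)).toList
  have hl : ∀ z ∈ l, z < 0 := by
    intro z hz
    rw [Multiset.mem_toList, Multiset.mem_filter] at hz; exact hz.2
  have hr : ∀ z ∈ r, 0 < z := by
    intro z hz
    rw [Multiset.mem_toList, Multiset.mem_filter] at hz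
    exact lt_of_le_of_ne (not_lt.mp hz.2) (hroot z hz.1).symm
  obtain ⟨pu, pd, d1, d2, a1, a2, a3, a4, c, hc, hc0⟩ := sandwich_lists l r hl hr
  have hcard : l.length + r.length = Q.natDegree := by
    rw [Multiset.length_toList, Multiset.length_toList, ← Multiset.card_add,
      Multiset.filter_add_not, hQ.natDegree_eq_card_roots]
  rw [hcard] at d1 d2
  refine ⟨pu, pd, d1, d2, a1, a2, a3, a4, ?_⟩
  have hfac : Q = C Q.leadingCoeff * ((l.map (fun z => X - C z)).prod *
      (r.map (fun z => X - C z)).prod) := by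
    conv_lhs => rw [hQ.eq_prod_roots]
    congr 1
    have : M = (l : Multiset ℝ) + (r : Multiset ℝ) := by
      simp only [l, r, Multiset.coe_toList]; rw [Multiset.filter_add_not]
    rw [← hM, this]
    simp
  have hsgn : ∀ r : List ℝ, ((r.map (fun z => C z - X)).prod) ^ 2 = ((r.map (fun z => X - C z)).prod : ℝ[X]) ^ 2 := by
    intro r
    induction r with
    | nil => simp
    | cons x r ih => simp only [List.map_cons, List.prod_cons, mul_pow, ih]; ring
  rw [mul_pow, hsgn, ← mul_pow] at hc
  set P := ((l.map (fun z => X - C z)).prod * (r.map (fun z => X - C z)).prod : ℝ[X])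
  have e1 : c * (P.eval 0) ^ 2 = 1 := by
    rw [← hc0, hc]; simp
  have e2 : Q.leadingCoeff * P.eval 0 = 1 := by
    rw [← h0]; conv_rhs => rw [hfac]
    simp
  have hP : P.eval 0 ≠ 0 := by intro h; rw [h, mul_zero] at e2; exact zero_ne_one e2
  have e3 : c = Q.leadingCoeff ^ 2 := by
    apply mul_right_cancel₀ (pow_ne_zero 2 hP)
    rw [e1, ← mul_pow, e2, one_pow]
  rw [hc, e3]
  conv_rhs => rw [hfac]
  rw [C_pow]; ring
end PartOne

section PartTwo
open Polynomial Polynomial.Chebyshev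

lemma T_growth (x : ℝ) (hx : 1 ≤ |x|) (n : ℕ) : |(T ℝ n).eval x| ≤ (3 * |x|) ^ n := by
  induction n using Nat.twoStepInduction with
  | zero => simp
  | one => simp; nlinarith
  | more n ih1 ih2 =>
    have e : T ℝ ((n + 2 : ℕ) : ℤ) = 2 * X * T ℝ ((n + 1 : ℕ) : ℤ) - T ℝ (n : ℤ) := by
      have := T_add_two ℝ (n : ℤ); push_cast; exact this
    rw [e]
    simp only [eval_sub, eval_mul, eval_X, eval_ofNat]
    have h1 : |2 * x * (T ℝ ((n + 1 : ℕ) : ℤ)).eval x - (T ℝ (n : ℤ)).eval x| ≤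
        2 * |x| * (3 * |x|) ^ (n + 1) + (3 * |x|) ^ n := by
      refine (abs_sub _ _).trans ?_
      rw [abs_mul, abs_mul, abs_two]
      gcongr
    refine h1.trans ?_
    have hp : 0 ≤ (3 * |x|) ^ n := by positivity
    have : (3 * |x|) ^ (n + 2) - (2 * |x| * (3 * |x|) ^ (n + 1) + (3 * |x|) ^ n)
        = (3 * |x|) ^ n * (3 * |x| ^ 2 - 1) := by ring
    have h3 : 0 ≤ 3 * |x| ^ 2 - 1 := by nlinarith
    nlinarith [mul_nonneg hp h3]

lemma coeff_bound {n : ℕ} {P : ℝ[X]} (hdeg : P.natDegree ≤ n) {M : ℝ} (hM : 0 < M)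
    (hP : ∀ x ∈ Set.Icc (-1 : ℝ) 1, |P.eval x| ≤ M) (i : ℕ) : |P.coeff i| ≤ M * 9 ^ n := by
  -- coefficients of the Taylor expansion at 1
  have key : ∀ Q : ℝ[X], Q.natDegree ≤ n → (∀ x ∈ Set.Icc (-1 : ℝ) 1, |Q.eval x| ≤ 1) → ∀ k,
      (taylor 1 Q).coeff k ≤ (taylor 1 (T ℝ n)).coeff k := by
    intro Q hQ hb k
    have h := eval_iterate_derivative_le_of_forall_abs_le_one (k := k) (le_refl (1:ℝ))
      (natDegree_le_iff_degree_le.mp hQ) hb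
    rw [taylor_coeff, taylor_coeff]
    rw [← factorial_smul_hasseDeriv] at h
    have hs : ∀ G : ℝ[X], eval 1 ((k.factorial • hasseDeriv k) G) =
        (k.factorial : ℝ) * eval 1 (hasseDeriv k G) := by
      intro G
      rw [LinearMap.smul_apply, nsmul_eq_mul, eval_mul, eval_natCast]
    rw [hs, hs] at h
    exact le_of_mul_le_mul_left h (by positivity)
  have key2 : ∀ k, |(taylor 1 P).coeff k| ≤ M * (taylor 1 (T ℝ n)).coeff k := by
    intro k
    have h1 := key (C M⁻¹ * P) ((natDegree_C_mul_le _ _).trans hdeg) (by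
      intro x hx
      rw [eval_mul, eval_C, abs_mul, abs_of_pos (inv_pos.mpr hM)]
      rw [inv_mul_le_iff₀ hM, mul_one]; exact hP x hx) k
    have h2 := key (C (-M⁻¹) * P) ((natDegree_C_mul_le _ _).trans hdeg) (by
      intro x hx
      rw [eval_mul, eval_C, abs_mul, abs_neg, abs_of_pos (inv_pos.mpr hM)]
      rw [inv_mul_le_iff₀ hM, mul_one]; exact hP x hx) k
    rw [taylor_mul, taylor_C, coeff_C_mul] at h1 h2
    rw [abs_le]
    rw [inv_mul_le_iff₀ hM] at h1
    rw [neg_mul, neg_le, le_inv_mul_iff₀ hM] at h2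
    constructor <;> linarith
  have dT : (taylor 1 (T ℝ n)).natDegree < n + 1 := by
    rw [natDegree_taylor, natDegree_T]; simp
  have dP : (taylor 1 P).natDegree < n + 1 := by
    rw [natDegree_taylor]; omega
  have hev : ∑ k ∈ Finset.range (n + 1), (taylor 1 (T ℝ n)).coeff k * 2 ^ k ≤ 9 ^ n := by
    rw [← eval_eq_sum_range' dT, taylor_eval]
    have h3 := T_growth 3 (by norm_num) n
    norm_num at h3 ⊢
    exact (le_abs_self _).trans h3
  have hexp : P = ∑ k ∈ Finset.range (n + 1), C ((taylor 1 P).coeff k) * (X - C 1) ^ k := by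
    conv_lhs => rw [← sum_taylor_eq P 1]
    rw [sum_over_range' _ (by simp) (n + 1) dP]
  have hc : ∀ k, |((X - C (1:ℝ)) ^ k).coeff i| ≤ 2 ^ k := by
    intro k
    rw [sub_eq_add_neg, ← Polynomial.C_neg, coeff_X_add_C_pow, abs_mul, abs_pow, abs_neg, abs_one, one_pow, one_mul, Nat.abs_cast]
    exact_mod_cast Nat.choose_le_two_pow k i
  have hci : P.coeff i = ∑ k ∈ Finset.range (n + 1), (taylor 1 P).coeff k * ((X - C (1:ℝ)) ^ k).coeff i := by
    conv_lhs => rw [hexp]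
    simp only [finsetSum_coeff, coeff_C_mul]
  rw [hci]
  calc _ ≤ ∑ k ∈ Finset.range (n + 1), |(taylor 1 P).coeff k * ((X - C (1:ℝ)) ^ k).coeff i| :=
        Finset.abs_sum_le_sum_abs _ _
    _ ≤ ∑ k ∈ Finset.range (n + 1), M * ((taylor 1 (T ℝ n)).coeff k * 2 ^ k) := by
        apply Finset.sum_le_sum
        intro k _
        rw [abs_mul, ← mul_assoc]
        exact mul_le_mul (key2 k) (hc k) (abs_nonneg _) ((abs_nonneg _).trans (key2 k))
    _ ≤ M * 9 ^ n := by
        rw [← Finset.mul_sum]; gcongr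

lemma cheb_kernel (m : ℕ) : ∃ W : ℝ[X], W.Splits ∧ W.natDegree = 2 * m ∧ W.eval 0 = 1 ∧
    (∀ y, |y| ≤ 1 → |W.eval y| ≤ 2) ∧
    (∀ y, W.eval y ^ 2 ≤ 5 / (1 + (2 * m + 1) ^ 2 * y ^ 2) + 9 * (3 * |y|) ^ (4 * m)) := by
  set n : ℕ := 2 * m + 1 with hn
  have hnR : (n : ℝ) = 2 * m + 1 := by rw [hn]; push_cast; ring
  have hnpos : (0:ℝ) < n := by rw [hnR]; positivity
  have hodd : Odd (n : ℤ) := ⟨m, by rw [hn]; push_cast; ring⟩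
  set P := T ℝ n with hP
  have hP0 : P ≠ 0 := T_ne_zero ℝ n
  have hPs : P.Splits := by
    rw [splits_iff_card_roots]
    have h := roots_T_real n
    rw [hP, natDegree_T, h]
    have h2 := roots_T_real_nodup n
    simp only [Finset.card_val, Int.natAbs_natCast]
    rw [Finset.card_image_of_injOn, Finset.card_range]
    exact (Finset.range n).nodup_map_iff_injOn.mp (roots_T_real_nodup n)
  have hroot : P.eval 0 = 0 := T_eval_zero_of_odd ℝ hodd
  obtain ⟨V, hV⟩ : X ∣ P := by rw [X_dvd_iff, coeff_zero_eq_eval_zero, hroot]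
  have hV0 : V ≠ 0 := by rintro rfl; rw [mul_zero] at hV; exact hP0 hV
  have hVs : V.Splits := hPs.of_dvd hP0 ⟨X, by rw [hV]; ring⟩
  have hVd : V.natDegree = 2 * m := by
    have h1 : P.natDegree = n := by rw [hP, natDegree_T]; simp
    rw [hV, natDegree_mul X_ne_zero hV0, natDegree_X] at h1
    omega
  have hVe : |V.eval 0| = n := by
    have h1 : (derivative P).eval 0 = V.eval 0 := by
      rw [hV, derivative_mul]; simp
    rw [← h1, hP, T_derivative_eq_U]
    have : ((n:ℤ) - 1) = 2 * (m:ℤ) := by rw [hn]; push_cast; ring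
    rw [this, eval_mul, U_eval_two_mul_zero]
    rw [abs_mul]
    have h2 : |(((m:ℤ).negOnePow : ℤ) : ℝ)| = 1 := by
      rcases Int.units_eq_one_or ((m:ℤ).negOnePow) with h | h <;> rw [h] <;> simp
    rw [h2]; simp
  have hVe0 : V.eval 0 ≠ 0 := by
    intro h; rw [h, abs_zero] at hVe; linarith
  have hPV : ∀ y, P.eval y = y * V.eval y := by intro y; rw [hV]; simp
  have hPbd : ∀ y, |y| ≤ 1 → |P.eval y| ≤ 1 := fun y hy => abs_eval_T_real_le_one n hy
  have hPlin : ∀ y, |y| ≤ 1 → |P.eval y| ≤ 2 * n * |y| := by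
    intro y hy
    have hy' := abs_le.mp hy
    set α := arcsin y
    have hsin : sin α = y := sin_arcsin hy'.1 hy'.2
    have hcos : y = cos (π / 2 - α) := by rw [cos_pi_div_two_sub, hsin]
    have h1 : P.eval y = cos (n * (π / 2 - α)) := by
      rw [hP]; conv_lhs => rw [hcos]
      rw [T_real_cos]; simp
    have h2 : cos (n * (π / 2)) = 0 := by
      rw [hnR, cos_eq_zero_iff]; exact ⟨m, by push_cast; ring⟩
    have h3 : P.eval y = sin (n * (π / 2)) * sin (n * α) := by
      rw [h1, mul_sub, cos_sub, h2]; ring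
    have h4 : |α| ≤ 2 * |y| := by
      have h5 := mul_abs_le_abs_sin (x := α) (by
        rw [abs_le]; exact ⟨neg_pi_div_two_le_arcsin y, arcsin_le_pi_div_two y⟩)
      rw [hsin] at h5
      have hpi : 0 < π := pi_pos
      have h6 : |α| ≤ π / 2 * |y| := by
        calc |α| = π / 2 * (2 / π * |α|) := by field_simp
          _ ≤ _ := by gcongr
      nlinarith [pi_le_four, abs_nonneg y]
    rw [h3, abs_mul]
    calc _ ≤ 1 * |n * α| := by
          exact mul_le_mul (abs_sin_le_one _) abs_sin_le_abs (abs_nonneg _) zero_le_one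
      _ = n * |α| := by rw [one_mul, abs_mul, Nat.abs_cast]
      _ ≤ n * (2 * |y|) := by gcongr
      _ = _ := by ring
  refine ⟨C (V.eval 0)⁻¹ * V, hVs.C_mul _, ?_, ?_, ?_, ?_⟩
  · rw [natDegree_C_mul (inv_ne_zero hVe0), hVd]
  · simp [hVe0]
  · -- bound by 2
    intro y hy
    rw [eval_mul, eval_C, abs_mul, abs_inv, hVe, inv_mul_le_iff₀ hnpos]
    rcases eq_or_ne y 0 with rfl | hy0
    · rw [hVe]; linarith
    · have h := hPlin y hy
      rw [hPV, abs_mul] at h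
      have : 0 < |y| := abs_pos.mpr hy0
      nlinarith
  · intro y
    rw [eval_mul, eval_C, mul_pow, ← sq_abs (V.eval 0)⁻¹, abs_inv, hVe, inv_pow]
    rw [← hnR]
    rcases le_total |y| 1 with hy | hy
    · have h1 : (V.eval y) ^ 2 ≤ 4 * n ^ 2 := by
        rcases eq_or_ne y 0 with rfl | hy0
        · rw [← sq_abs, hVe]; nlinarith
        · have h := hPlin y hy
          rw [hPV, abs_mul] at h
          have : 0 < |y| := abs_pos.mpr hy0
          have h5 : |V.eval y| ≤ 2 * n := by nlinarith
          rw [← sq_abs]; nlinarith [abs_nonneg (V.eval y)]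
      have h2 : y ^ 2 * V.eval y ^ 2 ≤ 1 := by
        have h := hPbd y hy
        rw [hPV] at h
        rw [← mul_pow, ← sq_abs]; nlinarith [abs_nonneg (y * V.eval y)]
      have h3 : ((n:ℝ) ^ 2)⁻¹ * V.eval y ^ 2 ≤ 5 / (1 + n ^ 2 * y ^ 2) := by
        rw [le_div_iff₀ (by positivity)]
        rw [mul_assoc, inv_mul_le_iff₀ (by positivity)]
        nlinarith [sq_nonneg (n:ℝ)]
      have : 0 ≤ 9 * (3 * |y|) ^ (4 * m) := by positivity
      linarith
    · have h := T_growth y hy n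
      have h1 : P.eval y = y * V.eval y := hPV y
      rw [← hP, h1, abs_mul] at h
      have hy0 : 0 < |y| := by linarith
      have h2 : |V.eval y| ≤ 3 * (3 * |y|) ^ (2 * m) := by
        have : (3 * |y|) ^ n = |y| * (3 * (3 * |y|) ^ (2 * m)) := by rw [hn, pow_succ]; ring
        rw [this] at h
        exact le_of_mul_le_mul_left h hy0
      have h3 : V.eval y ^ 2 ≤ 9 * (3 * |y|) ^ (4 * m) := by
        rw [← sq_abs]
        calc |V.eval y| ^ 2 ≤ (3 * (3 * |y|) ^ (2 * m)) ^ 2 := by gcongr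
          _ = _ := by ring
      have h4 : ((n:ℝ) ^ 2)⁻¹ * V.eval y ^ 2 ≤ V.eval y ^ 2 := by
        apply mul_le_of_le_one_left (sq_nonneg _)
        apply inv_le_one_of_one_le₀
        have : (1:ℝ) ≤ n := by rw [hnR]; linarith [Nat.cast_nonneg (α := ℝ) m]
        nlinarith
      have : 0 ≤ 5 / (1 + (n:ℝ) ^ 2 * y ^ 2) := by positivity
      linarith
end PartTwo

section PartThree
open Polynomial

lemma pow_integrable (n : ℕ) : Integrable (fun s : ℝ => s ^ n) (gaussianReal 0 1) := by
  have h := memLp_id_gaussianReal (μ := 0) (v := 1) (n : NNReal)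
  have h2 := h.integrable_norm_pow'
  refine h2.mono' (by fun_prop) ?_
  filter_upwards with s
  simp

lemma poly_integrable (p : ℝ[X]) : Integrable (fun s : ℝ => p.eval s) (gaussianReal 0 1) := by
  have : (fun s : ℝ => p.eval s) = fun s => ∑ i ∈ Finset.range (p.natDegree + 1), p.coeff i * s ^ i := by
    funext s; exact eval_eq_sum_range s
  rw [this]
  exact integrable_finsetSum _ (fun i _ => (pow_integrable i).const_mul _)

lemma pdf_le_half (x : ℝ) : gaussianPDFReal 0 1 x ≤ 1 / 2 := by
  rw [gaussianPDFReal]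
  have h1 : (2:ℝ) ≤ √(2 * π * (1 : NNReal)) := by
    apply Real.le_sqrt_of_sq_le
    simp; linarith [pi_gt_three]
  have h2 : rexp (-(x - 0) ^ 2 / (2 * (1 : NNReal))) ≤ 1 := by
    apply Real.exp_le_one_iff.mpr
    simp only [NNReal.coe_one, sub_zero]
    nlinarith [sq_nonneg x]
  have h3 : (√(2 * π * (1 : NNReal)))⁻¹ ≤ 1 / 2 := by
    rw [one_div]; exact inv_anti₀ (by norm_num) h1
  calc _ ≤ (1 / 2 : ℝ) * 1 := by
        apply mul_le_mul h3 h2 (by positivity) (by norm_num)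
    _ = _ := by ring

lemma gauss_Ico (a b : ℝ) (hab : a ≤ b) : (gaussianReal 0 1).real (Set.Ico a b) ≤ (b - a) / 2 := by
  rw [Measure.real, gaussianReal_apply_eq_integral 0 (by norm_num)]
  rw [ENNReal.toReal_ofReal (integral_nonneg (fun x => gaussianPDFReal_nonneg _ _ _))]
  calc ∫ x in Set.Ico a b, gaussianPDFReal 0 1 x ≤ ∫ x in Set.Ico a b, (1 / 2 : ℝ) := by
        apply integral_mono
        · exact (integrable_gaussianPDFReal 0 1).integrableOn
        · simp
        · intro x; exact pdf_le_half x
    _ = _ := by simp [hab]; ring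

lemma gauss_tail (T : ℝ) (hT : 0 ≤ T) : (gaussianReal 0 1).real (Set.Ici T) ≤ rexp (-T ^ 2 / 2) := by
  have h := measure_ge_le_exp_mul_mgf (X := id) (μ := gaussianReal 0 1) T hT (by
    have := integrable_exp_mul_gaussianReal (μ := 0) (v := 1) T
    simpa using this)
  rw [mgf_id_gaussianReal] at h
  refine (le_of_eq_of_le ?_ h).trans (le_of_eq ?_)
  · rfl
  · simp only [NNReal.coe_one]
    rw [← Real.exp_add]; congr 1; ring

lemma gauss_neg (S : Set ℝ) (hS : MeasurableSet S) :
    (gaussianReal 0 1).real ((fun x => -x) ⁻¹' S) = (gaussianReal 0 1).real S := by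
  have h := gaussianReal_map_neg (μ := 0) (v := 1)
  rw [neg_zero] at h
  rw [Measure.real, Measure.real]
  conv_rhs => rw [← h]
  rw [Measure.map_apply measurable_neg hS]

lemma gauss_cauchy (a τ : ℝ) (ha : 0 < a) :
    Integrable (fun s => 5 / (1 + (a * (s - τ)) ^ 2)) (gaussianReal 0 1) ∧
    ∫ s, 5 / (1 + (a * (s - τ)) ^ 2) ∂(gaussianReal 0 1) ≤ 10 / a := by
  have hIntg : Integrable (fun s => 5 / (1 + (a * (s - τ)) ^ 2)) (volume : Measure ℝ) := by
    have h1 := integrable_inv_one_add_sq.comp_mul_left' ha.ne'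
    have h2 := (h1.comp_sub_right τ).const_mul 5
    simpa [div_eq_mul_inv] using h2
  have hmeas : Measurable (fun s => 5 / (1 + (a * (s - τ)) ^ 2)) := by fun_prop
  have hval : ∫ s, 5 / (1 + (a * (s - τ)) ^ 2) = 5 * (π / a) := by
    have h1 := integral_sub_right_eq_self (μ := (volume : Measure ℝ)) (fun s => 5 / (1 + (a * s) ^ 2)) τ
    rw [h1]
    have h2 := Measure.integral_comp_mul_left (fun s : ℝ => 5 / (1 + s ^ 2)) a
    rw [h2]
    simp only [div_eq_mul_inv, integral_const_mul, integral_univ_inv_one_add_sq]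
    rw [abs_of_pos (inv_pos.mpr ha), smul_eq_mul]; ring
  constructor
  · refine Integrable.of_bound hmeas.aestronglyMeasurable 5 ?_
    filter_upwards with s
    rw [Real.norm_of_nonneg (by positivity)]
    apply div_le_self (by norm_num)
    nlinarith [sq_nonneg (a * (s - τ))]
  · rw [integral_gaussianReal_eq_integral_smul (by norm_num)]
    calc ∫ x, gaussianPDFReal 0 1 x • (5 / (1 + (a * (x - τ)) ^ 2))
        ≤ ∫ x, (1 / 2) * (5 / (1 + (a * (x - τ)) ^ 2)) := by
          apply integral_mono_of_nonneg
          · filter_upwards with x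
            exact mul_nonneg (gaussianPDFReal_nonneg _ _ _) (by positivity)
          · exact hIntg.const_mul _
          · filter_upwards with x
            exact mul_le_mul_of_nonneg_right (pdf_le_half x) (by positivity)
      _ = 1 / 2 * (5 * (π / a)) := by rw [integral_const_mul, hval]
      _ ≤ 10 / a := by
          rw [div_eq_mul_inv, div_eq_mul_inv, div_eq_mul_inv]
          have := pi_le_four
          have h3 : 0 < a⁻¹ := inv_pos.mpr ha
          nlinarith

lemma gauss_moment (N : ℕ) (hN : 1 ≤ N) (τ : ℝ) (hτ : |τ| ≤ √N / 2) :
    Integrable (fun s => (|s - τ| / √N) ^ N) (gaussianReal 0 1) ∧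
    ∫ s, (|s - τ| / √N) ^ N ∂(gaussianReal 0 1) ≤ 2 := by
  set q := √(N:ℝ) with hq
  have hNR : (1:ℝ) ≤ N := by exact_mod_cast hN
  have hqq : q * q = N := Real.mul_self_sqrt (by linarith)
  have hqpos : 0 < q := Real.sqrt_pos.mpr (by linarith)
  have hi1 := integrable_exp_mul_gaussianReal (μ := 0) (v := 1) q
  have hi2 := integrable_exp_mul_gaussianReal (μ := 0) (v := 1) (-q)
  have hv1 : ∫ s, rexp (q * s) ∂(gaussianReal 0 1) = rexp (N / 2) := by
    have := congrFun (mgf_id_gaussianReal (μ := 0) (v := 1)) q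
    rw [mgf] at this
    simp only [id, NNReal.coe_one, zero_mul, zero_add, one_mul, sq, hqq] at this
    exact this
  have hv2 : ∫ s, rexp (-q * s) ∂(gaussianReal 0 1) = rexp (N / 2) := by
    have := congrFun (mgf_id_gaussianReal (μ := 0) (v := 1)) (-q)
    rw [mgf] at this
    simp only [id, NNReal.coe_one, zero_mul, zero_add, one_mul, sq, neg_mul_neg, hqq] at this
    exact this
  have hpt : ∀ s, (|s - τ| / q) ^ N ≤ rexp (-(N / 2)) * (rexp (q * s) + rexp (-q * s)) := by
    intro s
    have h1 : |s - τ| / q ≤ rexp (|s - τ| / q - 1) := by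
      have := Real.add_one_le_exp (|s - τ| / q - 1); linarith
    have h2 : (|s - τ| / q) ^ N ≤ rexp (q * |s - τ| - N) := by
      calc (|s - τ| / q) ^ N ≤ rexp (|s - τ| / q - 1) ^ N := by gcongr
        _ = rexp (N * (|s - τ| / q - 1)) := by rw [← Real.exp_nat_mul]
        _ = _ := by
          congr 1; rw [← hqq]; field_simp
    have h3 : q * |s - τ| - N ≤ -(N / 2) + q * |s| := by
      have h4 : |s - τ| ≤ |s| + |τ| := abs_sub _ _
      nlinarith
    have h5 : rexp (q * |s|) ≤ rexp (q * s) + rexp (-q * s) := by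
      rcases abs_cases s with h | h <;> rw [h.1]
      · linarith [Real.exp_pos (-q * s)]
      · rw [show q * -s = -q * s by ring]; linarith [Real.exp_pos (q * s)]
    calc _ ≤ rexp (-(N / 2) + q * |s|) := h2.trans (Real.exp_le_exp.mpr h3)
      _ = rexp (-(N / 2)) * rexp (q * |s|) := Real.exp_add _ _
      _ ≤ _ := by gcongr
  have hib := (hi1.add hi2).const_mul (rexp (-((N:ℝ) / 2)))
  constructor
  · refine hib.mono' (by fun_prop) ?_
    filter_upwards with s
    rw [Real.norm_of_nonneg (by positivity)]
    exact hpt s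
  · calc _ ≤ ∫ s, rexp (-((N:ℝ) / 2)) * (rexp (q * s) + rexp (-q * s)) ∂(gaussianReal 0 1) := by
          apply integral_mono_of_nonneg
          · filter_upwards with s; positivity
          · exact hib
          · filter_upwards with s; exact hpt s
      _ = rexp (-((N:ℝ) / 2)) * (rexp (N / 2) + rexp (N / 2)) := by
          rw [integral_const_mul, integral_add hi1 hi2, hv1, hv2]
      _ = 2 := by
          rw [← two_mul, mul_left_comm, ← Real.exp_add]; simp

/-- The data of a one-dimensional sandwich at threshold `τ`. -/
def Sand (k : ℕ) (τ : ℝ) (pu pd : ℝ[X]) : Prop :=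
  pu.natDegree ≤ k ∧ pd.natDegree ≤ k ∧ (∀ i, |pu.coeff i| ≤ 5 * 9 ^ k) ∧
  (∀ i, |pd.coeff i| ≤ 5 * 9 ^ k) ∧
  (∀ s, s ≤ τ → 1 ≤ pu.eval s) ∧ (∀ s, τ ≤ s → 0 ≤ pu.eval s) ∧
  (∀ s, s ≤ τ → pd.eval s ≤ 1) ∧ (∀ s, τ ≤ s → pd.eval s ≤ 0)

lemma sand_trivial (k : ℕ) (τ : ℝ) : Sand k τ 1 0 := by
  have h9 : (1:ℝ) ≤ 9 ^ k := one_le_pow₀ (by norm_num)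
  refine ⟨by simp, by simp, ?_, ?_, by simp, by simp, by simp, by simp⟩
  · intro i; rw [coeff_one]; split_ifs <;> simp <;> linarith
  · intro i; simp

lemma gauss_sq : ∫ s, s ^ 2 ∂(gaussianReal 0 1) = 1 := by
  have h := variance_fun_id_gaussianReal (μ := 0) (v := 1)
  rw [variance_of_integral_eq_zero (by fun_prop) (by simp)] at h
  simpa using h

lemma sand_tail (k : ℕ) (hk : 2 ≤ k) (τ : ℝ) (hτ : 1 ≤ τ ^ 2) : ∃ pu pd, Sand k τ pu pd ∧
    ∫ s, (pu.eval s - pd.eval s) ∂(gaussianReal 0 1) ≤ 1 / τ ^ 2 := by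
  have h9 : (1:ℝ) ≤ 9 ^ k := one_le_pow₀ (by norm_num)
  have hpos : 0 < τ ^ 2 := by linarith
  have hi : (τ ^ 2)⁻¹ ≤ 1 := inv_le_one_of_one_le₀ hτ
  have hi0 : 0 < (τ ^ 2)⁻¹ := inv_pos.mpr hpos
  have hIntg : ∫ s, (τ ^ 2)⁻¹ * s ^ 2 ∂(gaussianReal 0 1) = 1 / τ ^ 2 := by
    rw [integral_const_mul, gauss_sq, mul_one, one_div]
  have hd : (C (τ ^ 2)⁻¹ * X ^ 2 : ℝ[X]).natDegree ≤ k := (natDegree_C_mul_X_pow_le _ _).trans hk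
  have hc : ∀ i, |(C (τ ^ 2)⁻¹ * X ^ 2 : ℝ[X]).coeff i| ≤ 1 := by
    intro i; rw [coeff_C_mul_X_pow]; split_ifs
    · rw [abs_of_pos hi0]; exact hi
    · simp
  have hsq : ∀ s : ℝ, τ ^ 2 ≤ s ^ 2 → 1 ≤ (τ ^ 2)⁻¹ * s ^ 2 := by
    intro s hs; rw [le_inv_mul_iff₀ hpos]; linarith
  rcases le_total 0 τ with h0 | h0
  · refine ⟨1, 1 - C (τ ^ 2)⁻¹ * X ^ 2, ⟨by simp, ?_, ?_, ?_, by simp, by simp, ?_, ?_⟩, ?_⟩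
    · refine (natDegree_sub_le_of_le (m := k) (n := k) (by simp) hd).trans (by simp)
    · intro i; rw [coeff_one]; split_ifs <;> simp <;> linarith
    · intro i; rw [coeff_sub]
      have := hc i
      have h1 : |(1:ℝ[X]).coeff i| ≤ 1 := by rw [coeff_one]; split_ifs <;> simp
      refine (abs_sub _ _).trans ?_
      linarith
    · intro s _; simp; positivity
    · intro s hs
      have := hsq s (by nlinarith)
      simp only [eval_sub, eval_mul, eval_pow, eval_X, eval_C, eval_one]; linarith
    · simp only [eval_sub, eval_mul, eval_pow, eval_X, eval_C, eval_one, sub_sub_cancel]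
      exact hIntg.le
  · refine ⟨C (τ ^ 2)⁻¹ * X ^ 2, 0, ⟨hd, by simp, ?_, ?_, ?_, ?_, by simp, by simp⟩, ?_⟩
    · intro i; linarith [hc i]
    · intro i; simp
    · intro s hs
      have := hsq s (by nlinarith)
      simp only [eval_mul, eval_pow, eval_X, eval_C]; exact this
    · intro s _; simp only [eval_mul, eval_pow, eval_X, eval_C]; positivity
    · simp only [eval_mul, eval_pow, eval_X, eval_C, eval_zero, sub_zero]
      exact hIntg.le

lemma sand_cheb (k m : ℕ) (hm : 1 ≤ m) (hk : 4 * m ≤ k) (τ : ℝ) (hτ : |τ| ≤ √m) :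
    ∃ pu pd, Sand k τ pu pd ∧
    ∫ s, (pu.eval s - pd.eval s) ∂(gaussianReal 0 1) ≤ 78 / √m := by
  obtain ⟨W, hWs, hWd, hW0, hW2, hWb⟩ := cheb_kernel m
  obtain ⟨pu, pd, d1, d2, a1, a2, a3, a4, he⟩ := sandwich_splits W hWs hW0
  have hmR : (1:ℝ) ≤ m := by exact_mod_cast hm
  set r := √(m:ℝ) with hr
  have hrr : r * r = m := Real.mul_self_sqrt (by linarith)
  have hr1 : 1 ≤ r := Real.one_le_sqrt.mpr hmR
  set L := 12 * r with hL
  have hLpos : 0 < L := by positivity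
  set φ : ℝ[X] := C L⁻¹ * (X - C τ) with hφ
  have hφe : ∀ s, φ.eval s = L⁻¹ * (s - τ) := by intro s; simp [hφ]
  have hφd : φ.natDegree ≤ 1 := by
    refine (natDegree_C_mul_le _ _).trans ?_
    rw [natDegree_X_sub_C]
  have hdeg : ∀ p : ℝ[X], p.natDegree ≤ 2 * W.natDegree → (p.comp φ).natDegree ≤ k := by
    intro p hp
    refine (natDegree_comp_le).trans ?_
    rw [hWd] at hp
    calc p.natDegree * φ.natDegree ≤ p.natDegree * 1 := by gcongr
      _ ≤ k := by omega
  have hLi : 0 < L⁻¹ := inv_pos.mpr hLpos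
  have hneg : ∀ s, s ≤ τ → L⁻¹ * (s - τ) ≤ 0 := fun s hs =>
    mul_nonpos_of_nonneg_of_nonpos hLi.le (by linarith)
  have hnonneg : ∀ s, τ ≤ s → 0 ≤ L⁻¹ * (s - τ) := fun s hs =>
    mul_nonneg hLi.le (by linarith)
  have hev : ∀ y, pu.eval y - pd.eval y = W.eval y ^ 2 := by
    intro y; rw [← eval_sub, he, eval_pow]
  have hub : ∀ y, |y| ≤ 1 → |pu.eval y| ≤ 5 ∧ |pd.eval y| ≤ 5 := by
    intro y hy
    have h1 := hev y
    have h2 : W.eval y ^ 2 ≤ 4 := by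
      have := hW2 y hy
      rw [← sq_abs]; nlinarith [abs_nonneg (W.eval y)]
    have h3 : 0 ≤ W.eval y ^ 2 := sq_nonneg _
    have h4 : 0 ≤ pu.eval y := by
      rcases le_total y 0 with h | h
      · linarith [a1 y h]
      · exact a2 y h
    have h5 : pd.eval y ≤ 1 := by
      rcases le_total y 0 with h | h
      · exact a3 y h
      · linarith [a4 y h]
    constructor <;> rw [abs_le] <;> constructor <;> linarith
  have hy1 : ∀ s ∈ Set.Icc (-1:ℝ) 1, |L⁻¹ * (s - τ)| ≤ 1 := by
    intro s hs
    rw [abs_mul, abs_of_pos hLi, inv_mul_le_iff₀ hLpos]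
    have h1 : |s| ≤ 1 := abs_le.mpr hs
    have := abs_sub s τ
    rw [hL]; linarith
  refine ⟨pu.comp φ, pd.comp φ, ⟨hdeg pu d1, hdeg pd d2, ?_, ?_, ?_, ?_, ?_, ?_⟩, ?_⟩
  · apply coeff_bound (hdeg pu d1) (by norm_num)
    intro s hs; rw [eval_comp, hφe]; exact (hub _ (hy1 s hs)).1
  · apply coeff_bound (hdeg pd d2) (by norm_num)
    intro s hs; rw [eval_comp, hφe]; exact (hub _ (hy1 s hs)).2
  · intro s hs; rw [eval_comp, hφe]; exact a1 _ (hneg s hs)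
  · intro s hs; rw [eval_comp, hφe]; exact a2 _ (hnonneg s hs)
  · intro s hs; rw [eval_comp, hφe]; exact a3 _ (hneg s hs)
  · intro s hs; rw [eval_comp, hφe]; exact a4 _ (hnonneg s hs)
  · have hsq4 : √((4 * m : ℕ) : ℝ) = 2 * r := by
      rw [Real.sqrt_eq_iff_mul_self_eq (by positivity) (by positivity)]
      push_cast; nlinarith
    obtain ⟨i2, v2⟩ := gauss_moment (4 * m) (by omega) τ (by rw [hsq4]; linarith)
    rw [hsq4] at i2 v2
    have hapos : (0:ℝ) < (2 * m + 1) * L⁻¹ := by positivity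
    obtain ⟨i1, v1⟩ := gauss_cauchy ((2 * m + 1) * L⁻¹) τ hapos
    have hpt : ∀ s, (pu.comp φ).eval s - (pd.comp φ).eval s ≤
        5 / (1 + ((2 * m + 1) * L⁻¹ * (s - τ)) ^ 2) + 9 * (1 / 2) ^ (4 * m) * (|s - τ| / (2 * r)) ^ (4 * m) := by
      intro s
      rw [eval_comp, eval_comp, hφe, hev]
      refine (hWb _).trans (le_of_eq ?_)
      congr 1
      · ring
      · rw [mul_assoc, ← mul_pow, abs_mul, abs_of_pos hLi, hL]
        congr 2
        field_simp
        ring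
    have h16 : ((1:ℝ) / 2) ^ (4 * m) ≤ 1 / r := by
      have h1 : (r:ℝ) ≤ 2 ^ (4 * m) := by
        have : (m:ℝ) < 2 ^ m := by exact_mod_cast Nat.lt_two_pow_self
        calc r ≤ r * r := by nlinarith
          _ = m := hrr
          _ ≤ 2 ^ m := this.le
          _ ≤ 2 ^ (4 * m) := by gcongr <;> [norm_num; omega]
      rw [one_div, inv_pow, one_div]
      exact inv_anti₀ (by linarith) h1
    have hL2 : 10 / ((2 * m + 1) * L⁻¹) ≤ 60 / r := by
      rw [div_le_div_iff₀ hapos (by linarith), hL]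
      rw [mul_inv]
      have : 60 * ((2 * (m:ℝ) + 1) * (12⁻¹ * r⁻¹)) = 10 * (r + (1 / 2) * r⁻¹) := by
        rw [← hrr]; field_simp; ring
      rw [this]
      have : 0 < r⁻¹ := by positivity
      linarith
    calc _ ≤ ∫ s, (5 / (1 + ((2 * m + 1) * L⁻¹ * (s - τ)) ^ 2) + 9 * (1 / 2) ^ (4 * m) * (|s - τ| / (2 * r)) ^ (4 * m)) ∂(gaussianReal 0 1) := by
          apply integral_mono
          · exact (poly_integrable _).sub (poly_integrable _)
          · exact i1.add (i2.const_mul _)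
          · exact hpt
      _ ≤ 60 / r + 9 * (1 / 2) ^ (4 * m) * 2 := by
          rw [integral_add i1 (i2.const_mul _), integral_const_mul]
          gcongr
          exact v1.trans hL2
      _ ≤ 60 / r + 9 * (1 / r) * 2 := by gcongr
      _ = 78 / r := by ring

lemma sand_main (k : ℕ) (hk : 2 ≤ k) (τ : ℝ) : ∃ pu pd, Sand k τ pu pd ∧
    ∫ s, (pu.eval s - pd.eval s) ∂(gaussianReal 0 1) ≤ 500 / (√k + τ ^ 2) := by
  have hkR : (2:ℝ) ≤ k := by exact_mod_cast hk
  set q := √(k:ℝ) with hq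
  have hqq : q * q = k := Real.mul_self_sqrt (by linarith)
  have hq1 : 1 ≤ q := Real.one_le_sqrt.mpr (by linarith)
  by_cases h : τ ^ 2 ≤ q
  · by_cases h20 : k < 20
    · refine ⟨1, 0, sand_trivial k τ, ?_⟩
      simp only [eval_one, eval_zero, sub_zero, integral_const, probReal_univ, smul_eq_mul, mul_one]
      rw [le_div_iff₀ (by positivity)]
      have : (k:ℝ) < 20 := by exact_mod_cast h20
      nlinarith
    · obtain ⟨m, hm1, hm2⟩ : ∃ m, 4 * m ≤ k ∧ k ≤ 4 * m + 3 := ⟨k / 4, by omega, by omega⟩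
      have hm5 : 5 ≤ m := by omega
      have hmR : (5:ℝ) ≤ m := by exact_mod_cast hm5
      have hkm : (k:ℝ) ≤ 4 * m + 3 := by exact_mod_cast hm2
      have hqm : q ≤ m := by nlinarith
      obtain ⟨pu, pd, hs, hi⟩ := sand_cheb k m (by omega) hm1 τ (by
        apply Real.le_sqrt_of_sq_le; rw [sq_abs]; linarith)
      refine ⟨pu, pd, hs, hi.trans ?_⟩
      set r := √(m:ℝ)
      have hrr : r * r = m := Real.mul_self_sqrt (by linarith)
      have hr1 : 1 ≤ r := Real.one_le_sqrt.mpr (by linarith)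
      rw [div_le_div_iff₀ (by linarith) (by positivity)]
      have : q ≤ 3 * r := by
        apply abs_le_of_sq_le_sq' _ (by linarith) |>.2
        nlinarith
      nlinarith
  · have hgt : q < τ ^ 2 := not_le.mp h
    obtain ⟨pu, pd, hs, hi⟩ := sand_tail k hk τ (by linarith)
    refine ⟨pu, pd, hs, hi.trans ?_⟩
    rw [div_le_div_iff₀ (by linarith) (by positivity)]
    nlinarith
end PartThree

section PartFour
open Polynomial

instance stdG_prob (d : ℕ) : IsProbabilityMeasure (_root_.stdGaussian d) := by
  unfold _root_.stdGaussian; infer_instance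

/-- The dot product as a continuous linear map. -/
def dotL {d : ℕ} (v : Fin d → ℝ) : (Fin d → ℝ) →L[ℝ] ℝ :=
  ∑ i, v i • ContinuousLinearMap.proj (R := ℝ) (φ := fun _ : Fin d => ℝ) i

lemma dotL_apply {d : ℕ} (v x : Fin d → ℝ) : dotL v x = dotp v x := by
  simp [dotL, dotp]

lemma dotp_measurable {d : ℕ} (v : Fin d → ℝ) : Measurable (dotp v) := by
  unfold dotp; fun_prop

lemma cov_eval (d : ℕ) (i j : Fin d) :
    cov[fun x : Fin d → ℝ => x i, fun x => x j; _root_.stdGaussian d] = if i = j then 1 else 0 := by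
  have hmp : ∀ i : Fin d, MeasurePreserving (fun x : Fin d → ℝ => x i) (_root_.stdGaussian d)
      (gaussianReal 0 1) := fun i => measurePreserving_eval (fun _ => gaussianReal 0 1) i
  split_ifs with h
  · subst h
    rw [covariance_self (measurable_pi_apply i).aemeasurable]
    have h1 := variance_fun_id_gaussianReal (μ := 0) (v := 1)
    rw [← (hmp i).map_eq, variance_map (X := fun x : ℝ => x) (Y := fun x : Fin d → ℝ => x i) (by fun_prop)
      (measurable_pi_apply i).aemeasurable] at h1
    exact h1
  · have hind : iIndepFun (fun (i : Fin d) (x : Fin d → ℝ) => x i) (_root_.stdGaussian d) := by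
      exact iIndepFun_pi (X := fun _ => id) (μ := fun _ : Fin d => gaussianReal 0 1) (by fun_prop)
    have hm : ∀ i : Fin d, MemLp (fun x : Fin d → ℝ => x i) 2 (_root_.stdGaussian d) := fun i =>
      (memLp_id_gaussianReal (μ := 0) (v := 1) 2).comp_measurePreserving (hmp i)
    exact (hind.indepFun h).covariance_eq_zero (hm i) (hm j)

lemma cov_dotp {d : ℕ} (v u : Fin d → ℝ) :
    cov[dotp v, dotp u; _root_.stdGaussian d] = dotp v u := by
  have hmp : ∀ i : Fin d, MeasurePreserving (fun x : Fin d → ℝ => x i) (_root_.stdGaussian d)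
      (gaussianReal 0 1) := fun i => measurePreserving_eval (fun _ => gaussianReal 0 1) i
  have hm : ∀ i : Fin d, MemLp (fun x : Fin d → ℝ => x i) 2 (_root_.stdGaussian d) := fun i =>
      (memLp_id_gaussianReal (μ := 0) (v := 1) 2).comp_measurePreserving (hmp i)
  have e : ∀ w : Fin d → ℝ, dotp w = fun x => ∑ i, w i * x i := fun w => rfl
  rw [e v, e u, covariance_fun_sum_fun_sum (fun i => (hm i).const_mul _) (fun i => (hm i).const_mul _)]
  simp only [covariance_const_mul_left, covariance_const_mul_right, cov_eval]
  simp [mul_comm]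

lemma mean_dotp {d : ℕ} (v : Fin d → ℝ) : ∫ x, dotp v x ∂(_root_.stdGaussian d) = 0 := by
  have hmp : ∀ i : Fin d, MeasurePreserving (fun x : Fin d → ℝ => x i) (_root_.stdGaussian d)
      (gaussianReal 0 1) := fun i => measurePreserving_eval (fun _ => gaussianReal 0 1) i
  have hm : ∀ i : Fin d, MemLp (fun x : Fin d → ℝ => x i) 2 (_root_.stdGaussian d) := fun i =>
      (memLp_id_gaussianReal (μ := 0) (v := 1) 2).comp_measurePreserving (hmp i)
  unfold dotp
  rw [integral_finsetSum _ (fun i _ => ((hm i).integrable (by norm_num)).const_mul _)]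
  apply Finset.sum_eq_zero
  intro i _
  rw [integral_const_mul]
  have h1 : ∫ s, s ∂(gaussianReal 0 1) = 0 := by simp
  rw [← (hmp i).map_eq, integral_map (measurable_pi_apply i).aemeasurable (by fun_prop)] at h1
  rw [h1, mul_zero]

lemma law_pair {d : ℕ} (v u : Fin d → ℝ) (hv : dotp v v = 1) (hu : dotp u u = 1)
    (hvu : dotp v u = 0) :
    (_root_.stdGaussian d).map (fun x => (dotp v x, dotp u x)) =
      (gaussianReal 0 1).prod (gaussianReal 0 1) := by
  have hmp : ∀ i : Fin d, MeasurePreserving (fun x : Fin d → ℝ => x i) (_root_.stdGaussian d)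
      (gaussianReal 0 1) := fun i => measurePreserving_eval (fun _ => gaussianReal 0 1) i
  have hind : iIndepFun (fun (i : Fin d) (x : Fin d → ℝ) => x i) (_root_.stdGaussian d) :=
    iIndepFun_pi (X := fun _ => id) (μ := fun _ : Fin d => gaussianReal 0 1) (by fun_prop)
  have hG : HasGaussianLaw (fun x : Fin d → ℝ => fun i => x i) (_root_.stdGaussian d) := by
    refine iIndepFun.hasGaussianLaw (X := fun (i : Fin d) (x : Fin d → ℝ) => x i) (fun i => ?_) hind
    refine ⟨?_⟩
    rw [(hmp i).map_eq]
    infer_instance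
  have h0 : HasGaussianLaw (fun x => (dotp v x, dotp u x)) (_root_.stdGaussian d) := by
    have := hG.map
      ((dotL v).prod (dotL u))
    refine this.congr ?_
    filter_upwards with x
    simp [dotL_apply]
  have hind := h0.indepFun_of_covariance_eq_zero (by rw [← hvu]; exact cov_dotp v u)
  have key : ∀ w : Fin d → ℝ, dotp w w = 1 → HasGaussianLaw (dotp w) (_root_.stdGaussian d) →
      (_root_.stdGaussian d).map (dotp w) = gaussianReal 0 1 := by
    intro w hw h
    have := h.map_eq_gaussianReal
    rw [mean_dotp, ← covariance_self (dotp_measurable w).aemeasurable, cov_dotp, hw] at this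
    simpa using this
  rw [(indepFun_iff_map_prod_eq_prod_map_map (dotp_measurable v).aemeasurable
    (dotp_measurable u).aemeasurable).mp hind]
  rw [key v hv h0.fst, key u hu h0.snd]

end PartFour

section PartFive
open Polynomial

lemma strip_integral {d : ℕ} (v u : Fin d → ℝ) (hv : dotp v v = 1) (hu : dotp u u = 1)
    (hvu : dotp v u = 0) (T : Set ℝ) (hT : MeasurableSet T) (p : ℝ[X]) :
    Integrable (fun x => Set.indicator (dotp v ⁻¹' T) (fun y => p.eval (dotp u y)) x)
      (_root_.stdGaussian d) ∧
    ∫ x, Set.indicator (dotp v ⁻¹' T) (fun y => p.eval (dotp u y)) x ∂(_root_.stdGaussian d) =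
      (gaussianReal 0 1).real T * ∫ s, p.eval s ∂(gaussianReal 0 1) := by
  have hlaw := law_pair v u hv hu hvu
  have hm : Measurable (fun x => (dotp v x, dotp u x)) :=
    (dotp_measurable v).prodMk (dotp_measurable u)
  have e : (fun x => Set.indicator (dotp v ⁻¹' T) (fun y => p.eval (dotp u y)) x) =
      (fun z : ℝ × ℝ => T.indicator (fun _ => (1:ℝ)) z.1 * p.eval z.2) ∘
        (fun x => (dotp v x, dotp u x)) := by
    funext x
    by_cases h : dotp v x ∈ T
    · rw [Set.indicator_of_mem (show x ∈ dotp v ⁻¹' T from h)]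
      simp [h]
    · rw [Set.indicator_of_notMem (show x ∉ dotp v ⁻¹' T from h)]
      simp [h]
  have hi : Integrable (fun z : ℝ × ℝ => T.indicator (fun _ => (1:ℝ)) z.1 * p.eval z.2)
      ((gaussianReal 0 1).prod (gaussianReal 0 1)) :=
    Integrable.mul_prod (((integrable_const (1:ℝ))).indicator hT) (poly_integrable p)
  rw [← hlaw] at hi
  refine ⟨?_, ?_⟩
  · rw [e]; exact hi.comp_measurable hm
  · rw [e]
    have h2 := integral_map hm.aemeasurable hi.aestronglyMeasurable
    simp only [Function.comp_def]
    rw [← h2, hlaw, integral_prod_mul (fun t => T.indicator (fun _ => (1:ℝ)) t) (fun s => p.eval s)]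
    congr 1
    rw [integral_indicator_const _ hT]; simp

lemma dotp_comm {d : ℕ} (v w : Fin d → ℝ) : dotp v w = dotp w v := by
  unfold dotp; exact Finset.sum_congr rfl (fun i _ => mul_comm _ _)

lemma dotp_lin {d : ℕ} (v w x : Fin d → ℝ) (a b : ℝ) :
    dotp (fun i => a * v i + b * w i) x = a * dotp v x + b * dotp w x := by
  unfold dotp; rw [Finset.mul_sum, Finset.mul_sum, ← Finset.sum_add_distrib]
  exact Finset.sum_congr rfl (fun i _ => by ring)

lemma dotp_linr {d : ℕ} (v w x : Fin d → ℝ) (a b : ℝ) :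
    dotp x (fun i => a * v i + b * w i) = a * dotp x v + b * dotp x w := by
  rw [dotp_comm, dotp_lin, dotp_comm v, dotp_comm w]

lemma dotp_self_nonneg {d : ℕ} (v : Fin d → ℝ) : 0 ≤ dotp v v :=
  Finset.sum_nonneg (fun i _ => mul_self_nonneg _)

lemma dotp_self_zero {d : ℕ} (v : Fin d → ℝ) (h : dotp v v = 0) : v = 0 := by
  unfold dotp at h
  rw [Finset.sum_eq_zero_iff_of_nonneg (fun i _ => mul_self_nonneg _)] at h
  funext i; simpa using h i (Finset.mem_univ i)

lemma exists_perp {d : ℕ} (hd : 2 ≤ d) (v : Fin d → ℝ) :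
    ∃ u, dotp u u = 1 ∧ dotp v u = 0 := by
  obtain ⟨w, hw, hvw⟩ : ∃ w : Fin d → ℝ, w ≠ 0 ∧ dotp v w = 0 := by
    let i0 : Fin d := ⟨0, by omega⟩
    let i1 : Fin d := ⟨1, by omega⟩
    have h01 : i0 ≠ i1 := by simp [i0, i1]
    by_cases h0 : v i0 = 0
    · refine ⟨Pi.single i0 1, by simp, ?_⟩
      simp [dotp, Pi.single_apply, h0]
    · refine ⟨fun i => (-v i1) * (Pi.single i0 1 : Fin d → ℝ) i + v i0 * (Pi.single i1 1 : Fin d → ℝ) i, ?_, ?_⟩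
      · intro h
        have := congrFun h i1
        simp [h01.symm, h0] at this
      · rw [dotp_comm, dotp_lin]; simp [dotp, Pi.single_apply]; ring
  have hpos : 0 < dotp w w := lt_of_le_of_ne (dotp_self_nonneg w) (fun h => hw (dotp_self_zero w h.symm))
  have hs : √(dotp w w) ≠ 0 := (Real.sqrt_pos.mpr hpos).ne'
  refine ⟨fun i => (√(dotp w w))⁻¹ * w i + 0 * w i, ?_, ?_⟩
  · rw [dotp_lin, dotp_linr]
    field_simp
    rw [Real.sq_sqrt hpos.le]; ring
  · rw [dotp_linr, hvw]; ring

lemma exists_frame {d : ℕ} (hd : 2 ≤ d) (v w : Fin d → ℝ) (hv : dotp v v = 1) (hw : dotp w w = 1) :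
    ∃ (u : Fin d → ℝ) (c σ : ℝ), dotp u u = 1 ∧ dotp v u = 0 ∧ c ^ 2 + σ ^ 2 = 1 ∧ 0 ≤ σ ∧
      σ ≤ angleOf v w ∧ ∀ x, dotp w x = c * dotp v x + σ * dotp u x := by
  set c := dotp v w with hc
  have hr : dotp (fun i => 1 * w i + (-c) * v i) (fun i => 1 * w i + (-c) * v i) = 1 - c ^ 2 := by
    rw [dotp_lin, dotp_linr, dotp_linr, hw, hv, dotp_comm w v, ← hc]; ring
  have hrn := dotp_self_nonneg (fun i => 1 * w i + (-c) * v i)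
  rw [hr] at hrn
  have hc1 : -1 ≤ c := by nlinarith
  have hc2 : c ≤ 1 := by nlinarith
  have hang : √(1 - c ^ 2) ≤ angleOf v w := by
    rw [angleOf, ← Real.sin_arccos]
    exact Real.sin_le (Real.arccos_nonneg _)
  by_cases h0 : 1 - c ^ 2 = 0
  · obtain ⟨u, hu1, hu2⟩ := exists_perp hd v
    refine ⟨u, c, 0, hu1, hu2, by linarith, le_rfl, Real.arccos_nonneg _, ?_⟩
    have := dotp_self_zero _ (hr.trans h0)
    intro x
    have hwv : w = fun i => c * v i + 0 * v i := by
      funext i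
      have := congrFun this i
      simp at this; linarith
    conv_lhs => rw [hwv]
    rw [dotp_lin]; ring
  · have hpos : 0 < 1 - c ^ 2 := lt_of_le_of_ne hrn (Ne.symm h0)
    have hs : √(1 - c ^ 2) ≠ 0 := (Real.sqrt_pos.mpr hpos).ne'
    have hsq : √(1 - c ^ 2) ^ 2 = 1 - c ^ 2 := Real.sq_sqrt hpos.le
    set σ := √(1 - c ^ 2) with hσ
    refine ⟨fun i => σ⁻¹ * w i + (-c * σ⁻¹) * v i, c, σ, ?_, ?_, by linarith, Real.sqrt_nonneg _, hang, ?_⟩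
    · rw [dotp_lin, dotp_linr, dotp_linr, hw, hv, dotp_comm w v, ← hc]
      field_simp; nlinarith
    · rw [dotp_comm, dotp_lin, hv, dotp_comm w v, ← hc]; field_simp; ring
    · intro x; rw [dotp_lin]; field_simp; ring

open MvPolynomial in
lemma coeff_linPow {d : ℕ} (u : Fin d → ℝ) (hu : ∀ j, |u j| ≤ 1) (n : ℕ) :
    ∀ m, |MvPolynomial.coeff m ((∑ j, MvPolynomial.C (u j) * MvPolynomial.X j) ^ n)| ≤ (d:ℝ) ^ n := by
  induction n with
  | zero => intro m; simp [MvPolynomial.coeff_one]; split_ifs <;> simp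
  | succ n ih =>
    intro m
    rw [pow_succ, Finset.mul_sum, MvPolynomial.coeff_sum]
    refine (Finset.abs_sum_le_sum_abs _ _).trans ?_
    have : ∀ j ∈ (Finset.univ : Finset (Fin d)), |MvPolynomial.coeff m ((∑ j, MvPolynomial.C (u j) * MvPolynomial.X j) ^ n * (MvPolynomial.C (u j) * MvPolynomial.X j))| ≤ (d:ℝ) ^ n := by
      intro j _
      rw [mul_left_comm, MvPolynomial.coeff_C_mul, MvPolynomial.coeff_mul_X', abs_mul]
      have hd : (0:ℝ) ≤ (d:ℝ) ^ n := by positivity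
      split_ifs
      · calc _ ≤ 1 * (d:ℝ) ^ n := mul_le_mul (hu j) (ih _) (abs_nonneg _) (by norm_num)
          _ = _ := one_mul _
      · simp
    refine (Finset.sum_le_sum this).trans ?_
    simp [pow_succ, mul_comm]

lemma mv_compose {d : ℕ} (hd : 2 ≤ d) (u : Fin d → ℝ) (hu : dotp u u = 1) (k : ℕ) (p : ℝ[X])
    (hp : p.natDegree ≤ k) (hc : ∀ i, |p.coeff i| ≤ 6 * 9 ^ k) :
    ∃ q : MvPolynomial (Fin d) ℝ, q.totalDegree ≤ k ∧ (∀ m, |q.coeff m| ≤ 6 * (d:ℝ) ^ (10 * k)) ∧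
      ∀ x, MvPolynomial.eval x q = p.eval (dotp u x) := by
  set L : MvPolynomial (Fin d) ℝ := ∑ j, MvPolynomial.C (u j) * MvPolynomial.X j with hL
  have hu1 : ∀ j, |u j| ≤ 1 := by
    intro j
    have : u j * u j ≤ 1 := by
      rw [← hu]; exact Finset.single_le_sum (f := fun i => u i * u i) (fun i _ => mul_self_nonneg _) (Finset.mem_univ j)
    rw [abs_le]; constructor <;> nlinarith
  have hd2 : (2:ℝ) ≤ d := by exact_mod_cast hd
  refine ⟨∑ i ∈ Finset.range (k + 1), MvPolynomial.C (p.coeff i) * L ^ i, ?_, ?_, ?_⟩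
  · refine MvPolynomial.totalDegree_finsetSum_le (fun i hi => ?_)
    have hLd : L.totalDegree ≤ 1 := by
      refine MvPolynomial.totalDegree_finsetSum_le (fun j _ => ?_)
      refine (MvPolynomial.totalDegree_mul _ _).trans ?_
      simp
    refine (MvPolynomial.totalDegree_mul _ _).trans ?_
    rw [MvPolynomial.totalDegree_C, zero_add]
    refine (MvPolynomial.totalDegree_pow _ _).trans ?_
    have : i ≤ k := by have := Finset.mem_range.mp hi; omega
    nlinarith
  · intro m
    rw [MvPolynomial.coeff_sum]
    refine (Finset.abs_sum_le_sum_abs _ _).trans ?_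
    have hterm : ∀ i ∈ Finset.range (k + 1), |MvPolynomial.coeff m (MvPolynomial.C (p.coeff i) * L ^ i)| ≤ 6 * 9 ^ k * (d:ℝ) ^ k := by
      intro i hi
      have hik : i ≤ k := by have := Finset.mem_range.mp hi; omega
      rw [MvPolynomial.coeff_C_mul, abs_mul]
      exact mul_le_mul (hc i) ((coeff_linPow u hu1 i m).trans (pow_le_pow_right₀ (by linarith) hik)) (abs_nonneg _) (by positivity)
    refine (Finset.sum_le_sum hterm).trans ?_
    simp only [Finset.sum_const, Finset.card_range, nsmul_eq_mul]
    have h1 : ((k + 1 : ℕ) : ℝ) ≤ (d:ℝ) ^ k := by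
      have : k + 1 ≤ 2 ^ k := Nat.lt_two_pow_self
      calc ((k + 1 : ℕ) : ℝ) ≤ ((2 ^ k : ℕ) : ℝ) := by exact_mod_cast this
        _ = 2 ^ k := by push_cast; rfl
        _ ≤ _ := pow_le_pow_left₀ (by norm_num) hd2 k
    have h2 : (9:ℝ) ^ k ≤ (d:ℝ) ^ (4 * k) := by
      rw [pow_mul]
      apply pow_le_pow_left₀ (by norm_num)
      calc (9:ℝ) ≤ 2 ^ 4 := by norm_num
        _ ≤ _ := pow_le_pow_left₀ (by norm_num) hd2 4
    calc ((k + 1 : ℕ) : ℝ) * (6 * 9 ^ k * (d:ℝ) ^ k) ≤ (d:ℝ) ^ k * (6 * (d:ℝ) ^ (4 * k) * (d:ℝ) ^ k) := by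
          gcongr
      _ = 6 * (d:ℝ) ^ (6 * k) := by ring
      _ ≤ 6 * (d:ℝ) ^ (10 * k) := by
          have := pow_le_pow_right₀ (show (1:ℝ) ≤ d by linarith) (show 6 * k ≤ 10 * k by omega)
          linarith
  · intro x
    rw [map_sum, eval_eq_sum_range' (Nat.lt_succ_of_le hp)]
    refine Finset.sum_congr rfl (fun i _ => ?_)
    simp [hL, dotp]

end PartFive

section PartSix
open Polynomial

lemma strip_sand (k : ℕ) (hk : 2 ≤ k) (lo hi : ℝ) : ∃ pu pd : ℝ[X],
    pu.natDegree ≤ k ∧ pd.natDegree ≤ k ∧ (∀ i, |pu.coeff i| ≤ 5 * 9 ^ k) ∧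
    (∀ i, |pd.coeff i| ≤ 5 * 9 ^ k) ∧ (∀ s, s ≤ hi → 1 ≤ pu.eval s) ∧ (∀ s, 0 ≤ pu.eval s) ∧
    (∀ s, pd.eval s ≤ 1) ∧ (∀ s, lo ≤ s → pd.eval s ≤ 0) ∧
    ∫ s, (pu.eval s - pd.eval s) ∂(gaussianReal 0 1) ≤
      500 / (√k + hi ^ 2) + 500 / (√k + lo ^ 2) +
        ((gaussianReal 0 1).real (Set.Iic hi) - (gaussianReal 0 1).real (Set.Iic lo)) := by
  obtain ⟨pu, qd, ⟨a1, a2, a3, a4, a5, a6, a7, a8⟩, ha⟩ := sand_main k hk hi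
  obtain ⟨qu, pd, ⟨b1, b2, b3, b4, b5, b6, b7, b8⟩, hb⟩ := sand_main k hk lo
  refine ⟨pu, pd, a1, b2, a3, b4, a5, ?_, ?_, b8, ?_⟩
  · intro s; rcases le_total s hi with h1 | h1
    · linarith [a5 s h1]
    · exact a6 s h1
  · intro s; rcases le_total s lo with h1 | h1
    · exact b7 s h1
    · linarith [b8 s h1]
  · have i1 := poly_integrable pu
    have i2 := poly_integrable pd
    have i3 := poly_integrable qu
    have i4 := poly_integrable qd
    have e : ∫ s, (pu.eval s - pd.eval s) ∂(gaussianReal 0 1) =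
        ∫ s, (pu.eval s - qd.eval s) ∂(gaussianReal 0 1) +
        ∫ s, (qu.eval s - pd.eval s) ∂(gaussianReal 0 1) +
        ∫ s, (qd.eval s - qu.eval s) ∂(gaussianReal 0 1) := by
      rw [integral_sub i1 i2, integral_sub i1 i4, integral_sub i3 i2, integral_sub i4 i3]; ring
    have hx : ∫ s, (qd.eval s - qu.eval s) ∂(gaussianReal 0 1) ≤
        ∫ s, ((Set.Iic hi).indicator (fun _ => (1:ℝ)) s - (Set.Iic lo).indicator (fun _ => (1:ℝ)) s)
          ∂(gaussianReal 0 1) := by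
      refine integral_mono (i4.sub i3) (((integrable_const (1:ℝ)).indicator measurableSet_Iic).sub
        ((integrable_const (1:ℝ)).indicator measurableSet_Iic)) ?_
      intro s
      have f1 : qd.eval s ≤ (Set.Iic hi).indicator (fun _ => (1:ℝ)) s := by
        by_cases hs : s ≤ hi
        · simp [hs, a7 s hs]
        · simp [hs, a8 s (not_le.mp hs).le]
      have f2 : (Set.Iic lo).indicator (fun _ => (1:ℝ)) s ≤ qu.eval s := by
        by_cases hs : s ≤ lo
        · simp [hs, b5 s hs]
        · simp [hs, b6 s (not_le.mp hs).le]
      dsimp only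
      linarith
    rw [integral_sub ((integrable_const (1:ℝ)).indicator measurableSet_Iic)
        ((integrable_const (1:ℝ)).indicator measurableSet_Iic),
      integral_indicator_const _ measurableSet_Iic, integral_indicator_const _ measurableSet_Iic] at hx
    simp only [smul_eq_mul, mul_one] at hx
    linarith

/-- The index of the strip containing `t`. -/
def idx (K : ℕ) (ε t : ℝ) : ℤ := max (-(K:ℤ) - 1) (min K ⌊t / ε⌋)

lemma idx_mem (K : ℕ) (ε t : ℝ) : idx K ε t ∈ Finset.Icc (-(K:ℤ) - 1) K := by
  unfold idx; rw [Finset.mem_Icc]; omega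

lemma idx_mid (K : ℕ) (ε t : ℝ) (hε : 0 < ε) (j : ℤ) (h1 : -(K:ℤ) ≤ j) (h2 : j < K) :
    idx K ε t = j ↔ t ∈ Set.Ico ((j:ℝ) * ε) (((j:ℝ) + 1) * ε) := by
  have : idx K ε t = j ↔ ⌊t / ε⌋ = j := by unfold idx; omega
  rw [this, Int.floor_eq_iff, le_div_iff₀ hε, div_lt_iff₀ hε]; rfl

lemma idx_top (K : ℕ) (ε t : ℝ) (hε : 0 < ε) :
    idx K ε t = K ↔ t ∈ Set.Ici ((K:ℝ) * ε) := by
  have : idx K ε t = K ↔ (K:ℤ) ≤ ⌊t / ε⌋ := by unfold idx; omega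
  rw [this, Int.le_floor, le_div_iff₀ hε]; simp

lemma idx_bot (K : ℕ) (ε t : ℝ) (hε : 0 < ε) :
    idx K ε t = -(K:ℤ) - 1 ↔ t ∈ Set.Iio (-(K:ℝ) * ε) := by
  have : idx K ε t = -(K:ℤ) - 1 ↔ ⌊t / ε⌋ < -(K:ℤ) := by unfold idx; omega
  rw [this, Int.floor_lt, div_lt_iff₀ hε]; simp

lemma idx_measurable (K : ℕ) (ε : ℝ) : Measurable (idx K ε) := by
  unfold idx
  exact measurable_const.max (measurable_const.min (Int.measurable_floor.comp (by fun_prop)))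

lemma idx_meas (K : ℕ) (ε : ℝ) (j : ℤ) : MeasurableSet {t | idx K ε t = j} :=
  idx_measurable K ε (measurableSet_singleton j)

lemma idx_surj (K : ℕ) (ε : ℝ) (hε : 0 < ε) (j : ℤ) (hj : j ∈ Finset.Icc (-(K:ℤ) - 1) K) :
    ∃ t, idx K ε t = j := by
  refine ⟨j * ε, ?_⟩
  rw [Finset.mem_Icc] at hj
  unfold idx
  rw [mul_div_cancel_right₀ _ hε.ne', Int.floor_intCast]; omega

lemma idx_sum_le (K : ℕ) (ε : ℝ) (S : Finset ℕ) (g : ℕ → ℤ) (hg : Function.Injective g) :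
    ∑ i ∈ S, (gaussianReal 0 1).real {t | idx K ε t = g i} ≤ 1 := by
  rw [← measureReal_biUnion_finset]
  · exact measureReal_le_one
  · intro a _ b _ hab
    rw [Function.onFun, Set.disjoint_left]
    intro t h1 h2
    exact hab (hg (h1.symm.trans h2))
  · intro i _; exact idx_meas K ε _

lemma sum_Icc_split (F : ℤ → ℝ) (K : ℕ) : ∑ j ∈ Finset.Icc (-(K:ℤ) - 1) K, F j =
    ∑ i ∈ Finset.range (K + 1), F i + ∑ i ∈ Finset.range (K + 1), F (-(i:ℤ) - 1) := by
  have h1 : Finset.Icc (-(K:ℤ) - 1) K = (Finset.range (K+1)).image (fun i : ℕ => (i:ℤ)) ∪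
      (Finset.range (K+1)).image (fun i : ℕ => -(i:ℤ) - 1) := by
    ext j
    simp only [Finset.mem_Icc, Finset.mem_union, Finset.mem_image, Finset.mem_range]
    constructor
    · intro h
      rcases le_or_gt 0 j with h0 | h0
      · left; exact ⟨j.toNat, by omega, by omega⟩
      · right; exact ⟨(-j-1).toNat, by omega, by omega⟩
    · rintro (⟨i, hi, rfl⟩ | ⟨i, hi, rfl⟩) <;> omega
  rw [h1, Finset.sum_union, Finset.sum_image, Finset.sum_image]
  · intro a _ b _ h; simpa using h
  · intro a _ b _ h; simpa using h
  · rw [Finset.disjoint_left]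
    intro j
    simp only [Finset.mem_image, Finset.mem_range]
    rintro ⟨a, _, rfl⟩ ⟨b, _, hb⟩; omega

lemma main_sum (K : ℕ) (α c σ ε : ℝ) (m : ℕ → ℝ) (hα : 1 ≤ α) (hσ : 0 ≤ σ) (hε : 0 < ε)
    (hcs : c ^ 2 + σ ^ 2 = 1) (hm0 : ∀ i, 0 ≤ m i) (hsum : ∑ i ∈ Finset.range (K + 1), m i ≤ 1)
    (hm : ∀ i < K, m i ≤ ε / 2) :
    ∑ i ∈ Finset.Ico 1 K, m i * (1000 * σ ^ 2 / (α ^ 2 * σ ^ 2 + c ^ 2 * ((i:ℝ) * ε) ^ 2)) ≤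
      2000 * σ / α := by
  rcases hσ.eq_or_lt with h0 | hσp
  · simp [← h0]
  rcases le_total (1 / 2) (σ ^ 2) with hbig | hbig
  · have hs : 1 / 2 ≤ σ := by nlinarith
    have hterm : ∀ i ∈ Finset.Ico 1 K,
        m i * (1000 * σ ^ 2 / (α ^ 2 * σ ^ 2 + c ^ 2 * ((i:ℝ) * ε) ^ 2)) ≤ m i * (2000 * σ / α) := by
      intro i _
      apply mul_le_mul_of_nonneg_left _ (hm0 i)
      rw [div_le_div_iff₀ (by positivity) (by positivity)]
      have q1 : 0 ≤ c ^ 2 * ((i:ℝ) * ε) ^ 2 := by positivity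
      have q2 : 1000 * σ ^ 2 * α ≤ 2000 * σ * (α ^ 2 * σ ^ 2) := by
        have : 1 ≤ α * (2 * σ) := by nlinarith
        have h3 : 0 ≤ σ ^ 2 * α := by positivity
        nlinarith [mul_le_mul_of_nonneg_left this h3]
      nlinarith [mul_nonneg hσp.le q1]
    refine (Finset.sum_le_sum hterm).trans ?_
    rw [← Finset.sum_mul]
    have : ∑ i ∈ Finset.Ico 1 K, m i ≤ 1 := by
      refine (Finset.sum_le_sum_of_subset_of_nonneg ?_ (fun i _ _ => hm0 i)).trans hsum
      intro i hi; simp at hi ⊢; omega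
    have hp : 0 ≤ 2000 * σ / α := by positivity
    nlinarith
  · have hc2 : 1 / 2 ≤ c ^ 2 := by linarith
    set b := |c| * ε with hb
    have hcp : 1 / 2 ≤ |c| := by
      rw [← sq_abs] at hc2; nlinarith [abs_nonneg c]
    have hbp : 0 < b := by positivity
    set a := α * σ with ha
    have hap : 0 < a := by positivity
    have hterm : ∀ i ∈ Finset.Ico 1 K,
        m i * (1000 * σ ^ 2 / (α ^ 2 * σ ^ 2 + c ^ 2 * ((i:ℝ) * ε) ^ 2)) ≤
          (ε / 2) * (2000 * σ ^ 2 / b) * (1 / (a + b * ((i:ℝ) - 1)) - 1 / (a + b * i)) := by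
      intro i hi
      rw [Finset.mem_Ico] at hi
      have hi1 : (1:ℝ) ≤ i := by exact_mod_cast hi.1
      have hB : 0 ≤ b * ((i:ℝ) - 1) := mul_nonneg hbp.le (by linarith)
      have e1 : α ^ 2 * σ ^ 2 + c ^ 2 * ((i:ℝ) * ε) ^ 2 = a ^ 2 + (b * i) ^ 2 := by
        rw [ha, hb, mul_pow, mul_pow, mul_pow, mul_pow, sq_abs]; ring
      rw [e1, mul_assoc (ε / 2)]
      refine mul_le_mul (hm i hi.2) ?_ (by positivity) (by positivity)
      have e2 : 1 / (a + b * ((i:ℝ) - 1)) - 1 / (a + b * i) =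
          b / ((a + b * ((i:ℝ) - 1)) * (a + b * i)) := by
        have : a + b * ((i:ℝ) - 1) ≠ 0 := by positivity
        have : a + b * (i:ℝ) ≠ 0 := by positivity
        field_simp; ring
      rw [e2, show 2000 * σ ^ 2 / b * (b / ((a + b * ((i:ℝ) - 1)) * (a + b * i))) =
        2000 * σ ^ 2 / ((a + b * ((i:ℝ) - 1)) * (a + b * i)) by field_simp]
      rw [div_le_div_iff₀ (by positivity) (by positivity)]
      have : (a + b * ((i:ℝ) - 1)) * (a + b * i) ≤ 2 * (a ^ 2 + (b * i) ^ 2) := by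
        nlinarith [sq_nonneg (a - b * i), mul_pos hbp (show 0 < a + b * (i:ℝ) by positivity)]
      nlinarith [mul_le_mul_of_nonneg_left this (sq_nonneg σ)]
    refine (Finset.sum_le_sum hterm).trans ?_
    rw [← Finset.mul_sum]
    have htel : ∀ n : ℕ, ∑ i ∈ Finset.Ico 1 n, (1 / (a + b * ((i:ℝ) - 1)) - 1 / (a + b * i)) ≤ 1 / a := by
      intro n
      rcases Nat.eq_zero_or_pos n with rfl | hn
      · simp; positivity
      have : ∑ i ∈ Finset.Ico 1 n, (1 / (a + b * ((i:ℝ) - 1)) - 1 / (a + b * i)) =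
          1 / a - 1 / (a + b * ((n:ℝ) - 1)) := by
        induction n, hn using Nat.le_induction with
        | base => simp
        | succ n hn ih => rw [Finset.sum_Ico_succ_top hn, ih]; push_cast; ring_nf
      rw [this]
      have hn1 : (1:ℝ) ≤ n := by exact_mod_cast hn
      have hB : 0 ≤ b * ((n:ℝ) - 1) := mul_nonneg hbp.le (by linarith)
      have : 0 ≤ 1 / (a + b * ((n:ℝ) - 1)) := by positivity
      linarith
    calc _ ≤ (ε / 2) * (2000 * σ ^ 2 / b) * (1 / a) :=
          mul_le_mul_of_nonneg_left (htel K) (by positivity)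
      _ = 1000 * σ / (α * |c|) := by rw [ha, hb]; field_simp; ring
      _ ≤ 2000 * σ / α := by
          rw [div_le_div_iff₀ (by positivity) (by positivity)]
          nlinarith [mul_pos hσp (show 0 < α by linarith)]

lemma side_sum (K : ℕ) (hK : 1 ≤ K) (α c σ ε : ℝ) (m e D : ℕ → ℝ) (hα : 1 ≤ α) (hσ : 0 ≤ σ)
    (hε : 0 < ε)
    (hcs : c ^ 2 + σ ^ 2 = 1) (hm0 : ∀ i, 0 ≤ m i) (hsum : ∑ i ∈ Finset.range (K + 1), m i ≤ 1)
    (hm : ∀ i < K, m i ≤ ε / 2) (hmK : m K ≤ ε) (he0 : e 0 ≤ 1) (heK : e K ≤ 1)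
    (hD0 : ∀ i, 0 ≤ D i) (hD : ∑ i ∈ Finset.Ico 1 K, D i ≤ 1)
    (he : ∀ i, 1 ≤ i → i < K →
      e i ≤ 1000 * σ ^ 2 / (α ^ 2 * σ ^ 2 + c ^ 2 * ((i:ℝ) * ε) ^ 2) + D i) :
    ∑ i ∈ Finset.range (K + 1), m i * e i ≤ 2000 * σ / α + 3 * ε := by
  rw [Finset.sum_range_succ, Finset.range_eq_Ico, Finset.sum_eq_sum_Ico_succ_bot (by omega)]
  have h1 := main_sum K α c σ ε m hα hσ hε hcs hm0 hsum hm
  have h2 : ∑ i ∈ Finset.Ico (0 + 1) K, m i * e i ≤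
      ∑ i ∈ Finset.Ico 1 K, m i * (1000 * σ ^ 2 / (α ^ 2 * σ ^ 2 + c ^ 2 * ((i:ℝ) * ε) ^ 2)) +
      ∑ i ∈ Finset.Ico 1 K, (ε / 2) * D i := by
    rw [← Finset.sum_add_distrib]
    refine Finset.sum_le_sum (fun i hi => ?_)
    rw [Finset.mem_Ico] at hi
    have a1 := mul_le_mul_of_nonneg_left (he i hi.1 hi.2) (hm0 i)
    have a2 := mul_le_mul_of_nonneg_right (hm i hi.2) (hD0 i)
    linarith
  rw [← Finset.mul_sum] at h2
  have h3 := mul_le_mul_of_nonneg_left he0 (hm0 0)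
  have h4 := mul_le_mul_of_nonneg_left heK (hm0 K)
  have h5 := hm 0 (by omega)
  have h6 := mul_le_mul_of_nonneg_left hD (show 0 ≤ ε / 2 by linarith)
  linarith

lemma D_sum (κ ε : ℝ) (hε : 0 < ε) (K : ℕ) :
    ∑ i ∈ Finset.Ico 1 K, |(gaussianReal 0 1).real (Set.Iic (κ * ((i:ℝ) * ε))) -
      (gaussianReal 0 1).real (Set.Iic (κ * (((i:ℝ) + 1) * ε)))| ≤ 1 := by
  set G : ℕ → ℝ := fun i => (gaussianReal 0 1).real (Set.Iic (κ * ((i:ℝ) * ε))) with hG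
  have hG0 : ∀ i, 0 ≤ G i := fun i => measureReal_nonneg
  have hG1 : ∀ i, G i ≤ 1 := fun i => measureReal_le_one
  have e : ∀ i : ℕ, (gaussianReal 0 1).real (Set.Iic (κ * (((i:ℝ) + 1) * ε))) = G (i + 1) := by
    intro i; simp [hG]
  simp_rw [e]
  change ∑ i ∈ Finset.Ico 1 K, |G i - G (i + 1)| ≤ 1
  rcases Nat.lt_or_ge K 1 with hK | hK
  · have : K = 0 := by omega
    subst this; simp
  rcases le_total 0 κ with h | h
  · have : ∀ i ∈ Finset.Ico 1 K, |G i - G (i + 1)| = G (i + 1) - G i := by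
      intro i _
      rw [abs_of_nonpos]; · ring
      have : G i ≤ G (i + 1) := by
        refine measureReal_mono (Set.Iic_subset_Iic.mpr ?_)
        apply mul_le_mul_of_nonneg_left _ h
        push_cast; nlinarith
      linarith
    rw [Finset.sum_congr rfl this, Finset.sum_Ico_sub _ hK]
    linarith [hG0 1, hG1 K]
  · have : ∀ i ∈ Finset.Ico 1 K, |G i - G (i + 1)| = -(G (i + 1) - G i) := by
      intro i _
      rw [abs_of_nonneg]; · ring
      have : G (i + 1) ≤ G i := by
        refine measureReal_mono (Set.Iic_subset_Iic.mpr ?_)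
        apply mul_le_mul_of_nonpos_left _ h
        push_cast; nlinarith
      linarith
    rw [Finset.sum_congr rfl this, Finset.sum_neg_distrib, Finset.sum_Ico_sub _ hK]
    linarith [hG1 1, hG0 K]

end PartSix

section PartSeven
open Polynomial

lemma band_sand (k : ℕ) (hk : 2 ≤ k) (x y : ℝ) : ∃ pu pd : ℝ[X],
    pu.natDegree ≤ k ∧ pd.natDegree ≤ k ∧ (∀ i, |pu.coeff i| ≤ 5 * 9 ^ k) ∧
    (∀ i, |pd.coeff i| ≤ 5 * 9 ^ k) ∧ (∀ s, s ≤ max x y → 1 ≤ pu.eval s) ∧ (∀ s, 0 ≤ pu.eval s) ∧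
    (∀ s, pd.eval s ≤ 1) ∧ (∀ s, min x y ≤ s → pd.eval s ≤ 0) ∧
    ∫ s, (pu.eval s - pd.eval s) ∂(gaussianReal 0 1) ≤
      500 / (√k + x ^ 2) + 500 / (√k + y ^ 2) +
        |(gaussianReal 0 1).real (Set.Iic x) - (gaussianReal 0 1).real (Set.Iic y)| := by
  obtain ⟨pu, pd, h1, h2, h3, h4, h5, h6, h7, h8, h9⟩ := strip_sand k hk (min x y) (max x y)
  refine ⟨pu, pd, h1, h2, h3, h4, h5, h6, h7, h8, h9.trans ?_⟩
  rcases le_total x y with h | h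
  · rw [max_eq_right h, min_eq_left h]
    have := neg_abs_le ((gaussianReal 0 1).real (Set.Iic x) - (gaussianReal 0 1).real (Set.Iic y))
    linarith
  · rw [max_eq_left h, min_eq_right h]
    have := le_abs_self ((gaussianReal 0 1).real (Set.Iic x) - (gaussianReal 0 1).real (Set.Iic y))
    linarith

/-- Disagreement indicator in planar coordinates. -/
def Fpl (c σ t s : ℝ) : ℝ := if sgn t = sgn (c * t + σ * s) then 0 else 1

lemma Fpl_pos (c σ t s : ℝ) (ht : 0 ≤ t) :
    Fpl c σ t s = if 0 ≤ c * t + σ * s then 0 else 1 := by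
  unfold Fpl sgn
  rw [if_pos ht]
  split_ifs <;> first | rfl | (exfalso; linarith) | simp_all

lemma Fpl_neg (c σ t s : ℝ) (ht : t < 0) :
    Fpl c σ t s = if 0 ≤ c * t + σ * s then 1 else 0 := by
  unfold Fpl sgn
  rw [if_neg (not_le.mpr ht)]
  split_ifs <;> first | rfl | (exfalso; linarith) | simp_all

lemma Fpl_mem (c σ t s : ℝ) : 0 ≤ Fpl c σ t s ∧ Fpl c σ t s ≤ 1 := by
  unfold Fpl; split_ifs <;> norm_num

/-- Increment of the Gaussian distribution function. -/
def Dinc (κ ε : ℝ) (i : ℕ) : ℝ := |(gaussianReal 0 1).real (Set.Iic (κ * ((i:ℝ) * ε))) -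
      (gaussianReal 0 1).real (Set.Iic (κ * (((i:ℝ) + 1) * ε)))|

/-- Main error term on the `i`-th strip. -/
def Mer (k : ℕ) (c σ ε : ℝ) (i : ℕ) : ℝ :=
  1000 * σ ^ 2 / (√k * σ ^ 2 + c ^ 2 * ((i:ℝ) * ε) ^ 2)

lemma mer_bound (k : ℕ) (hk : 2 ≤ k) (c σ ε : ℝ) (hε : 0 < ε) (hσ : 0 < σ) (κ : ℝ)
    (hκ : κ ^ 2 = (c / σ) ^ 2) (i : ℕ) :
    500 / (√k + (κ * ((i:ℝ) * ε)) ^ 2) + 500 / (√k + (κ * (((i:ℝ) + 1) * ε)) ^ 2) ≤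
      Mer k c σ ε i := by
  have hk0 : 0 < √(k:ℝ) := Real.sqrt_pos.mpr (by exact_mod_cast (by omega : 0 < k))
  have h1 : Mer k c σ ε i = 1000 / (√k + (κ * ((i:ℝ) * ε)) ^ 2) := by
    unfold Mer; rw [mul_pow κ, hκ]
    field_simp
  have h2 : 500 / (√k + (κ * (((i:ℝ) + 1) * ε)) ^ 2) ≤ 500 / (√k + (κ * ((i:ℝ) * ε)) ^ 2) := by
    apply div_le_div_of_nonneg_left (by norm_num) (by positivity)
    rw [mul_pow, mul_pow]
    have : ((i:ℝ) * ε) ^ 2 ≤ (((i:ℝ) + 1) * ε) ^ 2 := by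
      apply pow_le_pow_left₀ (by positivity); nlinarith
    nlinarith [mul_le_mul_of_nonneg_left this (sq_nonneg κ)]
  rw [h1]
  have : (1000:ℝ) / (√k + (κ * ((i:ℝ) * ε)) ^ 2) = 500 / (√k + (κ * ((i:ℝ) * ε)) ^ 2) +
    500 / (√k + (κ * ((i:ℝ) * ε)) ^ 2) := by ring
  linarith

lemma between_mul (κ a b t : ℝ) (h1 : a ≤ t) (h2 : t ≤ b) :
    min (κ * a) (κ * b) ≤ κ * t ∧ κ * t ≤ max (κ * a) (κ * b) := by
  rcases le_total 0 κ with h | h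
  · exact ⟨(min_le_left _ _).trans (mul_le_mul_of_nonneg_left h1 h),
      (mul_le_mul_of_nonneg_left h2 h).trans (le_max_right _ _)⟩
  · exact ⟨(min_le_right _ _).trans (mul_le_mul_of_nonpos_left h2 h),
      (mul_le_mul_of_nonpos_left h1 h).trans (le_max_left _ _)⟩

/-- Sandwiching data for one strip. -/
def StripOK (k : ℕ) (S : Set ℝ) (c σ E : ℝ) (P Q : ℝ[X]) : Prop :=
  P.natDegree ≤ k ∧ Q.natDegree ≤ k ∧ (∀ i, |P.coeff i| ≤ 6 * 9 ^ k) ∧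
    (∀ i, |Q.coeff i| ≤ 6 * 9 ^ k) ∧
    (∀ t s, t ∈ S → Q.eval s ≤ Fpl c σ t s ∧ Fpl c σ t s ≤ P.eval s) ∧
    ∫ s, (P.eval s - Q.eval s) ∂(gaussianReal 0 1) ≤ E

lemma one_coeff_bd (k i : ℕ) : |(1 : ℝ[X]).coeff i| ≤ 9 ^ k := by
  have h9 : (1:ℝ) ≤ 9 ^ k := one_le_pow₀ (by norm_num)
  rw [coeff_one]; split_ifs
  · simpa using h9
  · simp

lemma strip_triv (k : ℕ) (S : Set ℝ) (c σ : ℝ) : StripOK k S c σ 1 1 0 := by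
  refine ⟨by simp, by simp, ?_, by simp, ?_, by simp⟩
  · intro i; have := one_coeff_bd k i; have : (0:ℝ) ≤ 9 ^ k := by positivity
    linarith
  · intro t s _; simpa using Fpl_mem c σ t s

lemma mer_nonneg (k : ℕ) (c σ ε : ℝ) (i : ℕ) : 0 ≤ Mer k c σ ε i := by unfold Mer; positivity

lemma dinc_nonneg (κ ε : ℝ) (i : ℕ) : 0 ≤ Dinc κ ε i := abs_nonneg _

lemma strip_const (k : ℕ) (S : Set ℝ) (c E : ℝ) (hc : c ^ 2 = 1) (hE : 0 ≤ E)
    (hS : ∀ t ∈ S, t ≠ 0) : ∃ P Q, StripOK k S c 0 E P Q := by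
  have hc' : c = 1 ∨ c = -1 := by
    have : (c - 1) * (c + 1) = 0 := by linear_combination hc
    rcases mul_eq_zero.mp this with h | h
    · left; linarith
    · right; linarith
  rcases hc' with rfl | rfl
  · refine ⟨0, 0, by simp, by simp, by simp, by simp, ?_, by simpa using hE⟩
    intro t s _; simp [Fpl]
  · refine ⟨1, 1, by simp, by simp, ?_, ?_, ?_, by simpa using hE⟩
    · intro i; have := one_coeff_bd k i; have : (0:ℝ) ≤ 9 ^ k := by positivity
      linarith
    · intro i; have := one_coeff_bd k i; have : (0:ℝ) ≤ 9 ^ k := by positivity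
      linarith
    · intro t s ht
      have h0 := hS t ht
      rcases lt_or_gt_of_ne h0 with h | h
      · rw [Fpl_neg _ _ _ _ h, if_pos (by linarith)]; simp
      · rw [Fpl_pos _ _ _ _ h.le, if_neg (by linarith)]; simp

lemma strip_right (k : ℕ) (hk : 2 ≤ k) (c σ ε : ℝ) (hσ : 0 ≤ σ) (hε : 0 < ε)
    (hcs : c ^ 2 + σ ^ 2 = 1) (i : ℕ) (hi : 1 ≤ i) : ∃ P Q,
    StripOK k (Set.Ico ((i:ℝ) * ε) (((i:ℝ) + 1) * ε)) c σ
      (Mer k c σ ε i + Dinc (-(c / σ)) ε i) P Q := by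
  have hi0 : 0 < (i:ℝ) * ε := mul_pos (by exact_mod_cast hi) hε
  rcases hσ.eq_or_lt with h0 | hσp
  · subst h0
    exact strip_const k _ c _ (by linarith) (add_nonneg (mer_nonneg _ _ _ _ _) (dinc_nonneg _ _ _))
      (fun t ht => (lt_of_lt_of_le hi0 ht.1).ne')
  obtain ⟨pu, pd, h1, h2, h3, h4, h5, h6, h7, h8, h9⟩ :=
    band_sand k hk (-(c / σ) * ((i:ℝ) * ε)) (-(c / σ) * (((i:ℝ) + 1) * ε))
  have h9' : (0:ℝ) ≤ 9 ^ k := by positivity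
  refine ⟨pu, pd, h1, h2, fun i => (h3 i).trans (by linarith), fun i => (h4 i).trans (by linarith),
    ?_, ?_⟩
  · intro t s ht
    have ht0 : 0 ≤ t := hi0.le.trans ht.1
    obtain ⟨b1, b2⟩ := between_mul (-(c / σ)) _ _ t ht.1 ht.2.le
    have hcσ : c * t + σ * s = σ * (s - -(c / σ) * t) := by field_simp; ring
    rw [Fpl_pos _ _ _ _ ht0]
    split_ifs with hs
    · refine ⟨h8 s (b1.trans ?_), h6 s⟩
      rw [hcσ] at hs
      have := nonneg_of_mul_nonneg_right hs hσp
      linarith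
    · refine ⟨h7 s, h5 s (le_trans ?_ b2)⟩
      by_contra hcon
      apply hs
      rw [hcσ]
      exact mul_nonneg hσp.le (by linarith)
  · have := mer_bound k hk c σ ε hε hσp (-(c / σ)) (by ring) i
    unfold Dinc
    linarith

lemma strip_left (k : ℕ) (hk : 2 ≤ k) (c σ ε : ℝ) (hσ : 0 ≤ σ) (hε : 0 < ε)
    (hcs : c ^ 2 + σ ^ 2 = 1) (i : ℕ) (hi : 1 ≤ i) : ∃ P Q,
    StripOK k (Set.Ico (-((i:ℝ) + 1) * ε) (-(i:ℝ) * ε)) c σ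
      (Mer k c σ ε i + Dinc (c / σ) ε i) P Q := by
  have hi0 : 0 < (i:ℝ) * ε := mul_pos (by exact_mod_cast hi) hε
  rcases hσ.eq_or_lt with h0 | hσp
  · subst h0
    exact strip_const k _ c _ (by linarith) (add_nonneg (mer_nonneg _ _ _ _ _) (dinc_nonneg _ _ _))
      (fun t ht => by have := ht.2; intro h; linarith)
  obtain ⟨pu, pd, h1, h2, h3, h4, h5, h6, h7, h8, h9⟩ :=
    band_sand k hk ((c / σ) * ((i:ℝ) * ε)) ((c / σ) * (((i:ℝ) + 1) * ε))
  have h9' : (0:ℝ) ≤ 9 ^ k := by positivity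
  refine ⟨1 - pd, 1 - pu, ?_, ?_, ?_, ?_, ?_, ?_⟩
  · exact (natDegree_sub_le _ _).trans (by simp [h2])
  · exact (natDegree_sub_le _ _).trans (by simp [h1])
  · intro j; rw [coeff_sub]
    refine (abs_sub _ _).trans ?_
    linarith [one_coeff_bd k j, h4 j]
  · intro j; rw [coeff_sub]
    refine (abs_sub _ _).trans ?_
    linarith [one_coeff_bd k j, h3 j]
  · intro t s ht
    have ht0 : t < 0 := by have := ht.2; linarith
    obtain ⟨b1, b2⟩ := between_mul (c / σ) ((i:ℝ) * ε) (((i:ℝ) + 1) * ε) (-t)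
      (by have := ht.2; linarith) (by have := ht.1; linarith)
    have hcσ : c * t + σ * s = σ * (s - (c / σ) * (-t)) := by field_simp; ring
    rw [Fpl_neg _ _ _ _ ht0]
    simp only [eval_sub, eval_one]
    split_ifs with hs
    · rw [hcσ] at hs
      have := nonneg_of_mul_nonneg_right hs hσp
      have := h8 s (b1.trans (by linarith))
      have := h6 s
      constructor <;> linarith
    · have := h7 s
      have := h5 s (le_trans (by
        by_contra hcon
        apply hs
        rw [hcσ]
        exact mul_nonneg hσp.le (by linarith)) b2)
      constructor <;> linarith
  · have := mer_bound k hk c σ ε hε hσp (c / σ) rfl i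
    have e : ∀ s, (1 - pd).eval s - (1 - pu).eval s = pu.eval s - pd.eval s := by
      intro s; simp
    simp_rw [e]
    unfold Dinc
    linarith

end PartSeven

section PartEight
open Polynomial

lemma tail_bd (K : ℕ) (ε : ℝ) (hε : 0 < ε) (hε1 : ε < 1)
    (hK : 2 * √(Real.log (2 / ε)) ≤ K * ε) :
    (gaussianReal 0 1).real (Set.Ici ((K:ℝ) * ε)) ≤ ε := by
  have hlog : 0 ≤ Real.log (2 / ε) := Real.log_nonneg (by rw [le_div_iff₀ hε]; linarith)
  refine (gauss_tail _ (by positivity)).trans ?_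
  have h1 : (2 * √(Real.log (2 / ε))) ^ 2 ≤ (K * ε) ^ 2 := pow_le_pow_left₀ (by positivity) hK 2
  rw [mul_pow, Real.sq_sqrt hlog] at h1
  calc rexp (-((K:ℝ) * ε) ^ 2 / 2) ≤ rexp (-Real.log (2 / ε)) := by
        apply Real.exp_le_exp.mpr; linarith
    _ = ε / 2 := by rw [Real.exp_neg, Real.exp_log (by positivity)]; field_simp
    _ ≤ ε := by linarith

lemma planar (k : ℕ) (hk : 2 ≤ k) (c σ ε α : ℝ) (hα : 1 ≤ α) (hα2 : α ^ 2 = √k) (hσ : 0 ≤ σ)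
    (hε : 0 < ε) (hε1 : ε < 1) (hcs : c ^ 2 + σ ^ 2 = 1) (K : ℕ) (hK1 : 1 ≤ K)
    (hK : 2 * √(Real.log (2 / ε)) ≤ K * ε) : ∃ P Q : ℤ → ℝ[X],
    (∀ j ∈ Finset.Icc (-(K:ℤ) - 1) K, ∃ E, StripOK k {t | idx K ε t = j} c σ E (P j) (Q j)) ∧
    ∑ j ∈ Finset.Icc (-(K:ℤ) - 1) K, (gaussianReal 0 1).real {t | idx K ε t = j} *
      ∫ s, ((P j).eval s - (Q j).eval s) ∂(gaussianReal 0 1) ≤ 4000 * σ / α + 6 * ε := by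
  have key : ∀ j : ℤ, ∃ P Q : ℝ[X], (j ∈ Finset.Icc (-(K:ℤ) - 1) K →
      ∃ E, StripOK k {t | idx K ε t = j} c σ E P Q) ∧
      (∀ i : ℕ, (i = 0 ∨ i = K) → (j = i ∨ j = -(i:ℤ) - 1) →
        ∫ s, (P.eval s - Q.eval s) ∂(gaussianReal 0 1) ≤ 1) ∧
      (∀ i : ℕ, 1 ≤ i → i < K → j = i →
        ∫ s, (P.eval s - Q.eval s) ∂(gaussianReal 0 1) ≤ Mer k c σ ε i + Dinc (-(c / σ)) ε i) ∧
      (∀ i : ℕ, 1 ≤ i → i < K → j = -(i:ℤ) - 1 →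
        ∫ s, (P.eval s - Q.eval s) ∂(gaussianReal 0 1) ≤ Mer k c σ ε i + Dinc (c / σ) ε i) := by
    intro j
    by_cases hR : 1 ≤ j ∧ j < K
    · obtain ⟨i, rfl⟩ : ∃ i : ℕ, j = i := ⟨j.toNat, by omega⟩
      obtain ⟨P, Q, h⟩ := strip_right k hk c σ ε hσ hε hcs i (by omega)
      have hset : {t | idx K ε t = (i:ℤ)} = Set.Ico ((i:ℝ) * ε) (((i:ℝ) + 1) * ε) := by
        ext t; rw [Set.mem_ofPred_eq, idx_mid K ε t hε i (by omega) (by omega)]; simp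
      refine ⟨P, Q, fun _ => ⟨_, hset ▸ h⟩, ?_, ?_, ?_⟩
      · intro i' _ _; omega
      · intro i' _ _ hi'
        have : i = i' := by omega
        subst this; exact h.2.2.2.2.2
      · intro i' _ _ _; omega
    by_cases hL : -(K:ℤ) ≤ j ∧ j ≤ -2
    · obtain ⟨i, rfl⟩ : ∃ i : ℕ, j = -(i:ℤ) - 1 := ⟨(-j-1).toNat, by omega⟩
      obtain ⟨P, Q, h⟩ := strip_left k hk c σ ε hσ hε hcs i (by omega)
      have hset : {t | idx K ε t = -(i:ℤ) - 1} = Set.Ico (-((i:ℝ) + 1) * ε) (-(i:ℝ) * ε) := by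
        ext t; rw [Set.mem_ofPred_eq, idx_mid K ε t hε _ (by omega) (by omega)]; push_cast
        rw [show -((i:ℝ) + 1) = -(i:ℝ) - 1 by ring, show -(i:ℝ) - 1 + 1 = -(i:ℝ) by ring]
      refine ⟨P, Q, fun _ => ⟨_, hset ▸ h⟩, ?_, ?_, ?_⟩
      · intro i' _ _; omega
      · intro i' _ _ _; omega
      · intro i' _ _ hi'
        have : i = i' := by omega
        subst this; exact h.2.2.2.2.2
    · refine ⟨1, 0, fun _ => ⟨1, strip_triv _ _ _ _⟩, ?_, ?_, ?_⟩
      · intro i' _ _; simp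
      · intro i' _ _ _; omega
      · intro i' _ _ _; omega
  choose P Q h1 h2 h3 h4 using key
  refine ⟨P, Q, h1, ?_⟩
  have hmid : ∀ j : ℤ, -(K:ℤ) ≤ j → j < K → (gaussianReal 0 1).real {t | idx K ε t = j} ≤ ε / 2 := by
    intro j a b
    have : {t | idx K ε t = j} = Set.Ico ((j:ℝ) * ε) (((j:ℝ) + 1) * ε) := by
      ext t; exact idx_mid K ε t hε j a b
    rw [this]
    refine (gauss_Ico _ _ (by nlinarith)).trans ?_
    linarith
  have htop : (gaussianReal 0 1).real {t | idx K ε t = (K:ℤ)} ≤ ε := by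
    have : {t | idx K ε t = (K:ℤ)} = Set.Ici ((K:ℝ) * ε) := by ext t; exact idx_top K ε t hε
    rw [this]; exact tail_bd K ε hε hε1 hK
  have hbot : (gaussianReal 0 1).real {t | idx K ε t = -(K:ℤ) - 1} ≤ ε := by
    have : {t | idx K ε t = -(K:ℤ) - 1} ⊆ (fun x => -x) ⁻¹' Set.Ici ((K:ℝ) * ε) := by
      intro t ht
      have := (idx_bot K ε t hε).mp ht
      simp at this ⊢; linarith
    refine (measureReal_mono this).trans ?_
    rw [gauss_neg _ measurableSet_Ici]
    exact tail_bd K ε hε hε1 hK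
  rw [sum_Icc_split]
  have hMer : ∀ i : ℕ, Mer k c σ ε i = 1000 * σ ^ 2 / (α ^ 2 * σ ^ 2 + c ^ 2 * ((i:ℝ) * ε) ^ 2) := by
    intro i; unfold Mer; rw [hα2]
  have A := side_sum K hK1 α c σ ε (fun i => (gaussianReal 0 1).real {t | idx K ε t = (i:ℤ)})
    (fun i => ∫ s, ((P i).eval s - (Q i).eval s) ∂(gaussianReal 0 1)) (Dinc (-(c / σ)) ε) hα hσ hε hcs
    (fun i => measureReal_nonneg) (idx_sum_le K ε _ _ Nat.cast_injective)
    (fun i hi => hmid i (by omega) (by omega)) htop (h2 _ 0 (Or.inl rfl) (Or.inl rfl))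
    (h2 _ K (Or.inr rfl) (Or.inl rfl)) (dinc_nonneg _ _) (D_sum _ ε hε K)
    (fun i a b => by rw [← hMer]; exact h3 _ i a b rfl)
  have B := side_sum K hK1 α c σ ε (fun i => (gaussianReal 0 1).real {t | idx K ε t = -(i:ℤ) - 1})
    (fun i => ∫ s, ((P (-(i:ℤ) - 1)).eval s - (Q (-(i:ℤ) - 1)).eval s) ∂(gaussianReal 0 1))
    (Dinc (c / σ) ε) hα hσ hε hcs
    (fun i => measureReal_nonneg) (idx_sum_le K ε _ (fun i => -(i:ℤ) - 1) (fun a b h => by simpa using h))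
    (fun i hi => hmid _ (by omega) (by omega)) hbot (h2 _ 0 (Or.inl rfl) (Or.inr rfl))
    (h2 _ K (Or.inr rfl) (Or.inr rfl)) (dinc_nonneg _ _) (D_sum _ ε hε K)
    (fun i a b => by rw [← hMer]; exact h4 _ i a b rfl)
  refine (add_le_add A B).trans (le_of_eq ?_)
  ring

end PartEight

/-- The disagreement region of two halfspaces admits a partition of `ℝ^d` into strips
`{a ≤ v·x < b}` (with endpoints among `±∞` and `j·ε`, `|j| ≤ k₁ = ⌈2√(log(2/ε))/ε⌉`)
with respect to which its indicator has
`(C·∠(v,v')·(log(k₂+2))^{3/2}/k₂^{1/4} + 10ε, C·d^{10k₂})`-sandwiching degree at most `k₂`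
in `L1` norm under `N(0, I_d)`, for all unit vectors `v'` simultaneously. -/
theorem sandwiching_degree_disagreement_L1 :
    ∃ C : ℝ, 1 ≤ C ∧
      ∀ (d : ℕ), 2 ≤ d → ∀ ε : ℝ, ε ∈ Set.Ioo (0:ℝ) 1 → ∀ k₂ : ℕ, 2 ≤ k₂ →
      ∀ v : Fin d → ℝ, IsUnitVec v →
      ∀ k₁ : ℤ, k₁ = ⌈2 * Real.sqrt (Real.log (2 / ε)) / ε⌉ →
      ∃ 𝒞 : Finset (Set (Fin d → ℝ)),
        (∀ A ∈ 𝒞, ∃ a b : EReal, a < b ∧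
          (a = ⊥ ∨ a = ⊤ ∨ ∃ j : ℤ, |j| ≤ k₁ ∧ a = (((j : ℝ) * ε : ℝ) : EReal)) ∧
          (b = ⊥ ∨ b = ⊤ ∨ ∃ j : ℤ, |j| ≤ k₁ ∧ b = (((j : ℝ) * ε : ℝ) : EReal)) ∧
          A = {x | a ≤ ((dotp v x : ℝ) : EReal) ∧ ((dotp v x : ℝ) : EReal) < b}) ∧
        (∀ A ∈ 𝒞, ∀ A' ∈ 𝒞, A ≠ A' → Disjoint A A') ∧
        ⋃₀ (𝒞 : Set (Set (Fin d → ℝ))) = Set.univ ∧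
        ∀ v' : Fin d → ℝ, IsUnitVec v' →
          SandwichL1 𝒞 (fun x => if sgn (dotp v x) = sgn (dotp v' x) then 0 else 1) k₂
            (C * angleOf v v' * (Real.log ((k₂ : ℝ) + 2)) ^ ((3:ℝ)/2) / (k₂ : ℝ) ^ ((1:ℝ)/4)
              + 10 * ε)
            (C * (d : ℝ) ^ (10 * k₂)) := by
  refine ⟨4000, by norm_num, ?_⟩
  intro d hd ε hε k hk v hv k₁ hk₁
  classical
  obtain ⟨hε0, hε1⟩ := hε
  have hlog : 0 < Real.log (2 / ε) := Real.log_pos (by rw [lt_div_iff₀ hε0]; linarith)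
  have hk1pos : 0 < k₁ := by
    rw [hk₁, Int.ceil_pos]
    have := Real.sqrt_pos.mpr hlog
    positivity
  obtain ⟨K, hKk⟩ : ∃ K : ℕ, k₁ = K := ⟨k₁.toNat, by omega⟩
  have hK1 : 1 ≤ K := by omega
  have hK : 2 * √(Real.log (2 / ε)) ≤ K * ε := by
    have h := Int.le_ceil (2 * √(Real.log (2 / ε)) / ε)
    rw [← hk₁, hKk, div_le_iff₀ hε0] at h
    simpa using h
  clear hk₁
  subst hKk
  have hvv : dotp v v = 1 := hv
  set J := Finset.Icc (-(K:ℤ) - 1) K with hJ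
  set A : ℤ → Set (Fin d → ℝ) := fun j => {x | idx K ε (dotp v x) = j} with hA
  have hmemA : ∀ j x, x ∈ A j ↔ idx K ε (dotp v x) = j := fun j x => Iff.rfl
  have hinj : Set.InjOn A J := by
    intro a ha b hb hab
    obtain ⟨t, ht⟩ := idx_surj K ε hε0 a ha
    have hx : dotp v (fun i => t * v i + 0 * v i) = t := by
      rw [dotp_linr, hvv]; ring
    have h1 : (fun i => t * v i + 0 * v i) ∈ A a := by rw [hmemA, hx]; exact ht
    rw [hab, hmemA, hx, ht] at h1
    exact h1
  refine ⟨J.image A, ?_, ?_, ?_, ?_⟩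
  · intro S hS
    obtain ⟨j, hj, rfl⟩ := Finset.mem_image.mp hS
    rw [hJ, Finset.mem_Icc] at hj
    by_cases htop : j = K
    · refine ⟨(((K:ℤ):ℝ) * ε : ℝ), ⊤, EReal.coe_lt_top _, Or.inr (Or.inr ⟨K, by simp, rfl⟩),
        Or.inr (Or.inl rfl), ?_⟩
      ext x
      rw [hmemA, htop, idx_top K ε _ hε0]
      simp [EReal.coe_lt_top, -EReal.coe_mul]
    by_cases hbot : j = -(K:ℤ) - 1
    · refine ⟨⊥, (((-(K:ℤ) : ℤ):ℝ) * ε : ℝ), EReal.bot_lt_coe _, Or.inl rfl,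
        Or.inr (Or.inr ⟨-(K:ℤ), by simp, rfl⟩), ?_⟩
      ext x
      rw [hmemA, hbot, idx_bot K ε _ hε0]
      simp [-EReal.coe_mul, -EReal.coe_neg]
    · refine ⟨((j:ℝ) * ε : ℝ), (((j + 1 : ℤ):ℝ) * ε : ℝ), ?_,
        Or.inr (Or.inr ⟨j, by rw [abs_le]; omega, rfl⟩),
        Or.inr (Or.inr ⟨j + 1, by rw [abs_le]; omega, rfl⟩), ?_⟩
      · rw [EReal.coe_lt_coe_iff]; push_cast; nlinarith
      · ext x
        rw [hmemA, idx_mid K ε _ hε0 j (by omega) (by omega)]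
        simp [-EReal.coe_mul, EReal.coe_le_coe_iff, EReal.coe_lt_coe_iff]
  · intro S hS S' hS' hne
    obtain ⟨j, hj, rfl⟩ := Finset.mem_image.mp hS
    obtain ⟨j', hj', rfl⟩ := Finset.mem_image.mp hS'
    rw [Set.disjoint_left]
    intro x h1 h2
    apply hne
    rw [hmemA] at h1 h2
    rw [← h1, ← h2]
  · apply Set.eq_univ_of_forall
    intro x
    refine ⟨A (idx K ε (dotp v x)), ?_, rfl⟩
    simp only [Finset.coe_image]
    exact ⟨_, idx_mem K ε _, rfl⟩
  · intro w hw
    obtain ⟨u, c, σ, hu, hvu, hcs, hσ, hσθ, hwx⟩ := exists_frame hd v w hvv hw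
    have hkR : (2:ℝ) ≤ k := by exact_mod_cast hk
    set α := (k:ℝ) ^ ((1:ℝ)/4) with hα
    have hα1 : 1 ≤ α := Real.one_le_rpow (by linarith) (by norm_num)
    have hα2 : α ^ 2 = √k := by
      rw [hα, ← Real.rpow_natCast, ← Real.rpow_mul (by linarith), Real.sqrt_eq_rpow]
      norm_num
    obtain ⟨P, Q, hPQ, hsum⟩ := planar k hk c σ ε α hα1 hα2 hσ hε0 hε1 hcs K hK1 hK
    have hmv : ∀ j, ∃ pu pd : MvPolynomial (Fin d) ℝ, j ∈ J →
        (pu.totalDegree ≤ k ∧ pd.totalDegree ≤ k ∧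
        (∀ m, |pu.coeff m| ≤ 6 * (d:ℝ) ^ (10 * k)) ∧ (∀ m, |pd.coeff m| ≤ 6 * (d:ℝ) ^ (10 * k)) ∧
        (∀ x, MvPolynomial.eval x pu = (P j).eval (dotp u x)) ∧
        (∀ x, MvPolynomial.eval x pd = (Q j).eval (dotp u x))) := by
      intro j
      by_cases hj : j ∈ J
      · obtain ⟨E, h1, h2, h3, h4, -, -⟩ := hPQ j hj
        obtain ⟨pu, a1, a2, a3⟩ := mv_compose hd u hu k (P j) h1 h3
        obtain ⟨pd, b1, b2, b3⟩ := mv_compose hd u hu k (Q j) h2 h4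
        exact ⟨pu, pd, fun _ => ⟨a1, b1, a2, b2, a3, b3⟩⟩
      · exact ⟨0, 0, fun h => absurd h hj⟩
    choose pu pd hp using hmv
    set g : Set (Fin d → ℝ) → ℤ := Function.invFunOn A J with hg
    have hgA : ∀ j ∈ J, g (A j) = j := fun j hj => hinj.leftInvOn_invFunOn hj
    have hd1 : (0:ℝ) ≤ (d:ℝ) ^ (10 * k) := by positivity
    have hpt : ∀ (q : ℤ → MvPolynomial (Fin d) ℝ) (x : Fin d → ℝ),
        ∑ S ∈ J.image A, Set.indicator S (fun y => MvPolynomial.eval y (q (g S))) x =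
          MvPolynomial.eval x (q (idx K ε (dotp v x))) := by
      intro q x
      rw [Finset.sum_image hinj, Finset.sum_eq_single (idx K ε (dotp v x))]
      · rw [hgA _ (idx_mem K ε _), Set.indicator_of_mem]
        rfl
      · intro j _ hne
        apply Set.indicator_of_notMem
        intro h
        exact hne h.symm
      · intro h; exact absurd (idx_mem K ε _) h
    refine ⟨fun S => pd (g S), fun S => pu (g S), ?_, ?_, ?_⟩
    · intro S hS
      obtain ⟨j, hj, rfl⟩ := Finset.mem_image.mp hS
      dsimp only
      rw [hgA j hj]
      obtain ⟨a1, a2, a3, a4, -, -⟩ := hp j hj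
      exact ⟨a2, a1, fun m => (a4 m).trans (by linarith), fun m => (a3 m).trans (by linarith)⟩
    · intro x
      have hjx := idx_mem K ε (dotp v x)
      rw [hpt pd x, hpt pu x]
      obtain ⟨-, -, -, -, a5, a6⟩ := hp _ hjx
      rw [a5, a6]
      dsimp only
      rw [hwx x]
      obtain ⟨E, -, -, -, -, h5, -⟩ := hPQ _ hjx
      exact h5 (dotp v x) (dotp u x) rfl
    · have hIntg : ∀ j ∈ J, Integrable (fun x => Set.indicator (A j) (fun y =>
          MvPolynomial.eval y (pu j) - MvPolynomial.eval y (pd j)) x) (_root_.stdGaussian d) ∧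
          ∫ x, Set.indicator (A j) (fun y =>
          MvPolynomial.eval y (pu j) - MvPolynomial.eval y (pd j)) x ∂(_root_.stdGaussian d) =
          (gaussianReal 0 1).real {t | idx K ε t = j} *
            ∫ s, ((P j).eval s - (Q j).eval s) ∂(gaussianReal 0 1) := by
        intro j hj
        obtain ⟨-, -, -, -, a5, a6⟩ := hp j hj
        have h := strip_integral v u hvv hu hvu {t | idx K ε t = j} (idx_meas K ε j) (P j - Q j)
        simp only [Polynomial.eval_sub] at h
        simp only [a5, a6]
        exact h
      have e1 : ∀ x, (∑ S ∈ J.image A, Set.indicator S (fun y =>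
          MvPolynomial.eval y (pu (g S)) - MvPolynomial.eval y (pd (g S))) x) =
          ∑ j ∈ J, Set.indicator (A j) (fun y =>
          MvPolynomial.eval y (pu j) - MvPolynomial.eval y (pd j)) x := by
        intro x
        rw [Finset.sum_image hinj]
        exact Finset.sum_congr rfl (fun j hj => by rw [hgA j hj])
      simp only [e1]
      rw [integral_finsetSum _ (fun j hj => (hIntg j hj).1),
        Finset.sum_congr rfl (fun j hj => (hIntg j hj).2)]
      refine hsum.trans ?_
      have hL : 1 ≤ (Real.log ((k:ℝ) + 2)) ^ ((3:ℝ)/2) := by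
        apply Real.one_le_rpow _ (by norm_num)
        rw [Real.le_log_iff_exp_le (by linarith)]
        linarith [Real.exp_one_lt_d9]
      have hθ : 0 ≤ angleOf v w := Real.arccos_nonneg _
      have h1 : 4000 * σ / α ≤
          4000 * angleOf v w * (Real.log ((k:ℝ) + 2)) ^ ((3:ℝ)/2) / α := by
        apply div_le_div_of_nonneg_right _ (by linarith)
        nlinarith [mul_le_mul_of_nonneg_left hL hθ]
      linarith

end
end

section
/- There exists an absolute constant C ≥ 1 such that for every integer k ≥ 4 and every real t, there exist real polynomials p_down and p_up in one variable, each of degree at most k and with all coefficients bounded by 2^{10k} in absolute value, such that p_down(z) ≤ 1_{z ≤ t} ≤ p_up(z) for all z ∈ ℝ, and E_{z∼N(0,1)}[(p_up(z) − p_down(z))²] ≤ C·(log(k+2))^{10}/√k; moreover if |t| ≥ 1 the polynomials can be chosen so that additionally E_{z∼N(0,1)}[(p_up(z) − p_down(z))²] ≤ C/t². -/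
open MeasureTheory ProbabilityTheory Real

noncomputable section

/-- Sum of the absolute values of the coefficients. -/
def sandL (p : Polynomial ℝ) : ℝ := p.sum fun _ a => |a|

open Polynomial in
lemma sandL_eq (p : Polynomial ℝ) (N : ℕ) (h : p.natDegree < N) :
    sandL p = ∑ i ∈ Finset.range N, |p.coeff i| :=
  Polynomial.sum_over_range' p (by simp) N h

lemma sandL_nonneg (p : Polynomial ℝ) : 0 ≤ sandL p := by
  rw [sandL_eq p _ (Nat.lt_succ_self _)]
  exact Finset.sum_nonneg fun i _ => abs_nonneg _

lemma coeff_le_sandL (p : Polynomial ℝ) (n : ℕ) : |p.coeff n| ≤ sandL p := by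
  rw [sandL_eq p (p.natDegree + 1 + n + 1) (by omega)]
  exact Finset.single_le_sum (f := fun i => |p.coeff i|) (fun i _ => abs_nonneg _)
    (Finset.mem_range.2 (by omega))

lemma sandL_add (p q : Polynomial ℝ) : sandL (p + q) ≤ sandL p + sandL q := by
  have h := Polynomial.natDegree_add_le p q
  rw [sandL_eq p (p.natDegree + q.natDegree + 1) (by omega),
    sandL_eq q (p.natDegree + q.natDegree + 1) (by omega),
    sandL_eq (p + q) (p.natDegree + q.natDegree + 1)
      (by have := max_le_add_of_nonneg (Nat.zero_le p.natDegree) (Nat.zero_le q.natDegree); omega),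
    ← Finset.sum_add_distrib]
  refine Finset.sum_le_sum fun i _ => ?_
  rw [Polynomial.coeff_add]
  exact abs_add_le _ _

lemma sandL_neg (p : Polynomial ℝ) : sandL (-p) = sandL p := by
  rw [sandL_eq p _ (Nat.lt_succ_self _), sandL_eq (-p) (p.natDegree + 1) (by simp)]
  simp

lemma sandL_sub (p q : Polynomial ℝ) : sandL (p - q) ≤ sandL p + sandL q := by
  rw [sub_eq_add_neg, ← sandL_neg q]
  exact sandL_add _ _

lemma sandL_C (a : ℝ) : sandL (Polynomial.C a) = |a| := by
  rw [sandL_eq _ 1 (by simp)]; simp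

lemma sandL_X : sandL Polynomial.X = 1 := by
  rw [sandL_eq _ 2 (by simp)]; simp [Finset.sum_range_succ]

lemma sandL_one : sandL 1 = 1 := by
  have := sandL_C 1
  simpa using this

lemma sandL_zero : sandL 0 = 0 := by
  have := sandL_C 0
  simpa using this

lemma sandL_C_mul (a : ℝ) (p : Polynomial ℝ) : sandL (Polynomial.C a * p) = |a| * sandL p := by
  rw [sandL_eq p _ (Nat.lt_succ_self _),
    sandL_eq _ (p.natDegree + 1) (Nat.lt_succ_of_le (Polynomial.natDegree_C_mul_le a p)),
    Finset.mul_sum]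
  simp [abs_mul]

lemma sandL_X_mul (p : Polynomial ℝ) : sandL (Polynomial.X * p) = sandL p := by
  rw [sandL_eq p _ (Nat.lt_succ_self _),
    sandL_eq (Polynomial.X * p) (p.natDegree + 1 + 1) (by
      have := Polynomial.natDegree_mul_le (p := (Polynomial.X : Polynomial ℝ)) (q := p)
      simp at this; omega), Finset.sum_range_succ']
  simp

lemma sandL_X_pow_mul (n : ℕ) (p : Polynomial ℝ) :
    sandL (Polynomial.X ^ n * p) = sandL p := by
  induction n with
  | zero => simp
  | succ n ih => rw [pow_succ', mul_assoc, sandL_X_mul, ih]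

lemma sandL_sum (s : Finset ℕ) (f : ℕ → Polynomial ℝ) :
    sandL (∑ i ∈ s, f i) ≤ ∑ i ∈ s, sandL (f i) := by
  classical
  induction s using Finset.induction_on with
  | empty => simp [sandL_zero]
  | insert a s ha ih =>
    rw [Finset.sum_insert ha, Finset.sum_insert ha]
    exact (sandL_add _ _).trans (by linarith)

lemma sandL_mul (p q : Polynomial ℝ) : sandL (p * q) ≤ sandL p * sandL q := by
  have h : p * q = ∑ i ∈ Finset.range (p.natDegree + 1),
      Polynomial.C (p.coeff i) * (Polynomial.X ^ i * q) := by
    conv_lhs => rw [p.as_sum_range_C_mul_X_pow]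
    rw [Finset.sum_mul]
    simp [mul_assoc]
  rw [h]
  refine (sandL_sum _ _).trans ?_
  rw [sandL_eq p _ (Nat.lt_succ_self _), Finset.sum_mul]
  refine Finset.sum_le_sum fun i _ => ?_
  rw [sandL_C_mul, sandL_X_pow_mul]

lemma sandL_pow_le_one (r : Polynomial ℝ) (hr : sandL r ≤ 1) (n : ℕ) : sandL (r ^ n) ≤ 1 := by
  induction n with
  | zero => simp [sandL_one]
  | succ n ih =>
    rw [pow_succ]
    exact (sandL_mul _ _).trans (mul_le_one₀ ih (sandL_nonneg _) hr)

lemma sandL_comp (p r : Polynomial ℝ) (hr : sandL r ≤ 1) : sandL (p.comp r) ≤ sandL p := by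
  rw [Polynomial.comp, Polynomial.eval₂_eq_sum_range]
  refine (sandL_sum _ _).trans ?_
  rw [sandL_eq p _ (Nat.lt_succ_self _)]
  refine Finset.sum_le_sum fun i _ => ?_
  rw [sandL_C_mul]
  exact mul_le_of_le_one_right (abs_nonneg _) (sandL_pow_le_one r hr i)

lemma eval_le_sandL (p : Polynomial ℝ) (k : ℕ) (hk : p.natDegree ≤ k) (x : ℝ) (hx : 1 ≤ |x|) :
    |p.eval x| ≤ sandL p * |x| ^ k := by
  rw [Polynomial.eval_eq_sum_range' (Nat.lt_succ_of_le hk),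
    sandL_eq p _ (Nat.lt_succ_of_le hk), Finset.sum_mul]
  refine (Finset.abs_sum_le_sum_abs _ _).trans (Finset.sum_le_sum fun i hi => ?_)
  rw [abs_mul, abs_pow]
  exact mul_le_mul_of_nonneg_left
    (pow_le_pow_right₀ hx (Nat.lt_succ_iff.1 (Finset.mem_range.1 hi))) (abs_nonneg _)

lemma eval_le_sandL_one (p : Polynomial ℝ) : |p.eval 1| ≤ sandL p := by
  simpa using eval_le_sandL p p.natDegree le_rfl 1 (by simp)

/-- Antiderivatives of polynomials. -/
lemma exists_antideriv (p : Polynomial ℝ) : ∃ F : Polynomial ℝ,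
    F.derivative = p ∧ F.natDegree ≤ p.natDegree + 1 ∧ sandL F ≤ sandL p := by
  refine ⟨∑ i ∈ Finset.range (p.natDegree + 1),
    Polynomial.C (p.coeff i / (i + 1)) * Polynomial.X ^ (i + 1), ?_, ?_, ?_⟩
  · conv_rhs => rw [p.as_sum_range_C_mul_X_pow]
    rw [Polynomial.derivative_sum]
    refine Finset.sum_congr rfl fun i _ => ?_
    rw [Polynomial.derivative_C_mul_X_pow]
    have : (i : ℝ) + 1 ≠ 0 := by positivity
    congr 2
    push_cast
    field_simp
  · refine Polynomial.natDegree_sum_le_of_forall_le _ _ fun i hi => ?_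
    refine (Polynomial.natDegree_C_mul_X_pow_le _ _).trans ?_
    have := Finset.mem_range.1 hi
    omega
  · refine (sandL_sum _ _).trans ?_
    rw [sandL_eq p _ (Nat.lt_succ_self _)]
    refine Finset.sum_le_sum fun i _ => ?_
    have h := sandL_X_pow_mul (i + 1) 1
    rw [mul_one, sandL_one] at h
    rw [sandL_C_mul, h, mul_one, abs_div]
    refine div_le_self (abs_nonneg _) ?_
    rw [abs_of_nonneg (by positivity)]
    linarith [(Nat.cast_nonneg i : (0 : ℝ) ≤ i)]

/-- Size of the coefficients of `T_n ∘ q`. -/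
lemma sandL_T_comp (q : Polynomial ℝ) (hq : sandL q ≤ 3) (n : ℕ) :
    sandL ((Polynomial.Chebyshev.T ℝ n).comp q) ≤ 7 ^ n ∧
    sandL ((Polynomial.Chebyshev.T ℝ (n + 1)).comp q) ≤ 7 ^ (n + 1) := by
  induction n with
  | zero => simp [sandL_one]; linarith
  | succ n ih =>
    refine ⟨by exact_mod_cast ih.2, ?_⟩
    have e : (((n + 1 : ℕ) : ℤ) + 1) = (n : ℤ) + 2 := by push_cast; ring
    rw [e, Polynomial.Chebyshev.T_add_two, Polynomial.sub_comp, Polynomial.mul_comp,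
      Polynomial.mul_comp, Polynomial.X_comp]
    refine (sandL_sub _ _).trans ?_
    have h2 : (2 : Polynomial ℝ).comp q = Polynomial.C 2 := by
      have : (2 : Polynomial ℝ) = Polynomial.C 2 := rfl
      rw [this, Polynomial.C_comp]
    rw [h2, mul_assoc, sandL_C_mul]
    have h3 := sandL_mul q ((Polynomial.Chebyshev.T ℝ (n + 1)).comp q)
    have h4 : sandL q * sandL ((Polynomial.Chebyshev.T ℝ (n + 1)).comp q) ≤ 3 * 7 ^ (n + 1) :=
      mul_le_mul hq ih.2 (sandL_nonneg _) (by norm_num)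
    have h5 := ih.1
    rw [abs_of_pos (by norm_num : (0 : ℝ) < 2)]
    have : (0 : ℝ) < 7 ^ n := by positivity
    rw [pow_succ] at h4
    rw [pow_succ, pow_succ]
    nlinarith

lemma cosh_small (d : ℝ) (h0 : 0 ≤ d) (h1 : d ≤ 1) : Real.cosh d ≤ 1 + 3 / 4 * d ^ 2 := by
  refine (Real.cosh_le_exp_half_sq d).trans ?_
  have hd : d ^ 2 ≤ 1 := by nlinarith
  have hd0 : 0 ≤ d ^ 2 := by positivity
  have := Real.abs_exp_sub_one_sub_id_le (x := d ^ 2 / 2) (by rw [abs_of_nonneg] <;> linarith)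
  have := (abs_le.1 this).2
  nlinarith

lemma T_lower (n : ℕ) (d w : ℝ) (h0 : 0 ≤ d) (h1 : d ≤ 1) (hw : 1 + 3 / 4 * d ^ 2 ≤ w) :
    Real.exp (n * d) / 2 ≤ (Polynomial.Chebyshev.T ℝ n).eval w := by
  have hw1 : 1 ≤ w := by nlinarith [sq_nonneg d]
  have hc : Real.cosh d ≤ Real.cosh (Real.arcosh w) := by
    rw [Real.cosh_arcosh hw1]
    exact (cosh_small d h0 h1).trans hw
  rw [Real.cosh_le_cosh, abs_of_nonneg h0, abs_of_nonneg (Real.arcosh_nonneg hw1)] at hc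
  rw [← Real.cosh_arcosh hw1, Polynomial.Chebyshev.T_real_cosh, Real.cosh_eq]
  have : Real.exp (n * d) ≤ Real.exp (((n : ℤ) : ℝ) * Real.arcosh w) := by
    apply Real.exp_le_exp.2
    push_cast
    exact mul_le_mul_of_nonneg_left hc (Nat.cast_nonneg n)
  have := Real.exp_pos (-(((n : ℤ) : ℝ) * Real.arcosh w))
  linarith

lemma poly_mvt (F : Polynomial ℝ) (a b c : ℝ) (hab : a ≤ b)
    (h : ∀ y, a ≤ y → y ≤ b → F.derivative.eval y ≤ c) : F.eval b - F.eval a ≤ c * (b - a) := by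
  have := (convex_Icc a b).image_sub_le_mul_sub_of_deriv_le (f := fun x => F.eval x)
    F.continuous.continuousOn F.differentiable.differentiableOn (C := c) (by
      intro x hx
      rw [interior_Icc] at hx
      rw [Polynomial.deriv]
      exact h x hx.1.le hx.2.le) a (Set.left_mem_Icc.2 hab) b (Set.right_mem_Icc.2 hab) hab
  exact this

lemma poly_mvt' (F : Polynomial ℝ) (a b c : ℝ) (hab : a ≤ b)
    (h : ∀ y, a ≤ y → y ≤ b → c ≤ F.derivative.eval y) : c * (b - a) ≤ F.eval b - F.eval a := by
  have := poly_mvt (-F) a b (-c) hab (by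
    intro y h1 h2
    have := h y h1 h2
    simp only [Polynomial.derivative_neg, Polynomial.eval_neg]
    linarith)
  simp only [Polynomial.eval_neg] at this
  linarith

/-- The one-sided polynomial approximation of the step function at `0`. -/
lemma exists_step (n : ℕ) (d : ℝ) (h0 : 0 < d) (h1 : d ≤ 1 / 2)
    (hM : 1 ≤ d * Real.exp (2 * (n * d)) / 16) :
    ∃ P : Polynomial ℝ, P.natDegree ≤ 4 * n + 2 ∧ sandL P ≤ 4 * 49 ^ n ∧
      (∀ x, 0 ≤ P.eval x) ∧ (∀ x ≤ 0, 1 ≤ P.eval x) ∧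
      (∀ x, -1 ≤ x → x ≤ 0 → P.eval x ≤ 1 + 2 / (d * Real.exp (2 * (n * d)) / 16)) ∧
      (∀ x, 0 ≤ x → x ≤ 1 → P.eval x ≤ 1) ∧
      (∀ x, 2 * d ≤ x → x ≤ 1 → P.eval x ≤ 1 / (d * Real.exp (2 * (n * d)) / 16)) := by
  set M0 := d * Real.exp (2 * (n * d)) / 16 with hM0
  set q : Polynomial ℝ := 1 + Polynomial.C (2 * d) * Polynomial.X - Polynomial.X * Polynomial.X
    with hq
  set S : Polynomial ℝ := (Polynomial.Chebyshev.T ℝ n).comp q with hS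
  set K : Polynomial ℝ := (1 - Polynomial.X) * (S * S) with hK
  have hqL : sandL q ≤ 3 := by
    refine (sandL_sub _ _).trans ?_
    have := sandL_add 1 (Polynomial.C (2 * d) * Polynomial.X)
    rw [sandL_C_mul, sandL_X, sandL_one, abs_of_pos (by linarith)] at this
    rw [sandL_X_mul, sandL_X]
    linarith
  have hSL : sandL S ≤ 7 ^ n := (sandL_T_comp q hqL n).1
  have hKL : sandL K ≤ 2 * 49 ^ n := by
    refine (sandL_mul _ _).trans ?_
    have e1 : sandL (1 - Polynomial.X) ≤ 2 := by
      refine (sandL_sub _ _).trans ?_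
      rw [sandL_one, sandL_X]; norm_num
    have e2 : sandL (S * S) ≤ 49 ^ n := by
      refine (sandL_mul _ _).trans ?_
      have : (49 : ℝ) ^ n = 7 ^ n * 7 ^ n := by rw [← mul_pow]; norm_num
      rw [this]
      exact mul_le_mul hSL hSL (sandL_nonneg _) (by positivity)
    exact mul_le_mul e1 e2 (sandL_nonneg _) (by norm_num)
  have hqd : q.natDegree ≤ 2 := by
    rw [hq]; compute_degree
  have hSd : S.natDegree ≤ 2 * n := by
    rw [hS, Polynomial.natDegree_comp, Polynomial.Chebyshev.natDegree_T]
    simp only [Int.natAbs_natCast]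
    nlinarith
  have hKd : K.natDegree ≤ 4 * n + 1 := by
    have a1 : (1 - Polynomial.X : Polynomial ℝ).natDegree ≤ 1 := by compute_degree
    have a2 := Polynomial.natDegree_mul_le (p := S) (q := S)
    have a3 := Polynomial.natDegree_mul_le (p := (1 - Polynomial.X : Polynomial ℝ)) (q := S * S)
    rw [← hK] at a3
    omega
  obtain ⟨F, hF, hFd, hFL⟩ := exists_antideriv K
  have hqe : ∀ y, q.eval y = 1 + 2 * d * y - y * y := by intro y; simp [hq]
  have hSe : ∀ y, S.eval y = (Polynomial.Chebyshev.T ℝ n).eval (1 + 2 * d * y - y * y) := by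
    intro y; rw [hS, Polynomial.eval_comp, hqe]
  have hKe : ∀ y, F.derivative.eval y = (1 - y) * (S.eval y * S.eval y) := by
    intro y; rw [hF, hK]; simp
  have hmono : ∀ a b, a ≤ b → b ≤ 1 → F.eval a ≤ F.eval b := by
    intro a b hab hb
    have := poly_mvt' F a b 0 hab (by
      intro y _ hy
      rw [hKe]
      exact mul_nonneg (by linarith) (mul_self_nonneg _))
    linarith
  have hanti : ∀ b, 1 ≤ b → F.eval b ≤ F.eval 1 := by
    intro b hb
    have := poly_mvt F 1 b 0 hb (by
      intro y hy _
      rw [hKe]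
      exact mul_nonpos_of_nonpos_of_nonneg (by linarith) (mul_self_nonneg _))
    linarith
  have hmax : ∀ x, F.eval x ≤ F.eval 1 := by
    intro x
    rcases le_total x 1 with h | h
    · exact hmono x 1 h le_rfl
    · exact hanti x h
  have hS1 : ∀ y, -1 ≤ y → y ≤ 1 → (y ≤ 0 ∨ 2 * d ≤ y) → S.eval y * S.eval y ≤ 1 := by
    intro y hy1 hy2 hy
    have : |S.eval y| ≤ 1 := by
      rw [hSe]
      apply Polynomial.Chebyshev.abs_eval_T_real_le_one
      rw [abs_le]
      rcases hy with hy | hy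
      · constructor <;> nlinarith
      · constructor <;> nlinarith
    have h2 := abs_mul_abs_self (S.eval y)
    nlinarith [abs_nonneg (S.eval y)]
  have hM : M0 ≤ F.eval 1 - F.eval 0 := by
    have a1 := hmono 0 (d / 2) (by linarith) (by linarith)
    have a2 := hmono (3 / 2 * d) 1 (by linarith) (by linarith)
    have a3 := poly_mvt' F (d / 2) (3 / 2 * d) (Real.exp (2 * (n * d)) / 16) (by linarith) (by
      intro y hy1 hy2
      rw [hKe]
      have b1 : Real.exp (n * d) / 2 ≤ S.eval y := by
        rw [hSe]
        apply T_lower n d _ h0.le (by linarith)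
        nlinarith
      have b2 : Real.exp (2 * (n * d)) = Real.exp (n * d) * Real.exp (n * d) := by
        rw [← Real.exp_add]; ring_nf
      have b3 : Real.exp (n * d) / 2 * (Real.exp (n * d) / 2) ≤ S.eval y * S.eval y :=
        mul_self_le_mul_self (by positivity) b1
      have b4 : (1 : ℝ) / 4 ≤ 1 - y := by linarith
      rw [b2]
      have b5 : 0 ≤ S.eval y * S.eval y := mul_self_nonneg _
      nlinarith)
    rw [hM0]
    linarith
  have hMpos : 0 < F.eval 1 - F.eval 0 := by linarith
  set M := F.eval 1 - F.eval 0 with hMdef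
  have hP : ∀ x, (Polynomial.C (1 / M) * (Polynomial.C (F.eval 1) - F)).eval x
      = (F.eval 1 - F.eval x) / M := by
    intro x; simp; ring
  refine ⟨Polynomial.C (1 / M) * (Polynomial.C (F.eval 1) - F), ?_, ?_, ?_, ?_, ?_, ?_, ?_⟩
  · refine (Polynomial.natDegree_C_mul_le _ _).trans ?_
    refine (Polynomial.natDegree_sub_le _ _).trans ?_
    simp only [Polynomial.natDegree_C]
    omega
  · rw [sandL_C_mul]
    have := sandL_sub (Polynomial.C (F.eval 1)) F
    rw [sandL_C] at this
    have h3 := eval_le_sandL_one F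
    have h4 : |1 / M| ≤ 1 := by
      rw [abs_of_pos (by positivity), div_le_one hMpos]
      linarith
    refine (mul_le_of_le_one_left (sandL_nonneg _) h4).trans ?_
    linarith
  · intro x
    rw [hP]
    exact div_nonneg (by linarith [hmax x]) hMpos.le
  · intro x hx
    rw [hP, le_div_iff₀ hMpos]
    linarith [hmono x 0 hx (by norm_num)]
  · intro x hx1 hx2
    have b1 := poly_mvt F x 0 2 hx2 (by
      intro y hy1 hy2
      rw [hKe]
      have := hS1 y (by linarith) (by linarith) (Or.inl hy2)
      have b5 : 0 ≤ S.eval y * S.eval y := mul_self_nonneg _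
      nlinarith)
    have b2 : F.eval 1 - F.eval x ≤ M + 2 := by linarith
    rw [hP, div_le_iff₀ hMpos]
    have : 2 / M0 * M ≥ 2 := by
      rw [ge_iff_le, div_mul_eq_mul_div, le_div_iff₀ (by linarith)]
      linarith
    nlinarith
  · intro x hx1 hx2
    rw [hP, div_le_one hMpos]
    linarith [hmono 0 x hx1 hx2]
  · intro x hx1 hx2
    have b1 := poly_mvt F x 1 1 hx2 (by
      intro y hy1 hy2
      rw [hKe]
      have := hS1 y (by linarith) (by linarith) (Or.inr (by linarith))
      have b5 : 0 ≤ S.eval y * S.eval y := mul_self_nonneg _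
      nlinarith)
    have b2 : F.eval 1 - F.eval x ≤ 1 := by linarith
    rw [hP, div_le_div_iff₀ hMpos (by linarith)]
    nlinarith

lemma gauss_bound (f : ℝ → ℝ) (t w a b c : ℝ) (ha : 0 ≤ a) (hw : 0 ≤ w) (hc : 0 ≤ c)
    (hf0 : ∀ z, 0 ≤ f z)
    (hf : ∀ z, f z ≤ (Set.Ioo (t - w) (t + w)).indicator (fun _ => a) z + b
      + c * Real.exp (z ^ 2 / 4)) :
    ∫ z, f z ∂(gaussianReal 0 1) ≤ 2 * w * a + b + 2 * c := by
  rw [integral_gaussianReal_eq_integral_smul (by norm_num)]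
  have hI1 : Integrable ((Set.Ioo (t - w) (t + w)).indicator (fun _ : ℝ => a)) := by
    rw [integrable_indicator_iff measurableSet_Ioo]
    simp
  have hI2 := (integrable_gaussianPDFReal 0 1).const_mul b
  have hI3 := (integrable_exp_neg_mul_sq (b := 1 / 4) (by norm_num)).const_mul (c / 2)
  have hpi : 2 ≤ √(2 * π) := by
    apply Real.le_sqrt_of_sq_le
    have := Real.pi_gt_three
    linarith
  have hinv : (√(2 * π))⁻¹ ≤ 1 / 2 := by
    rw [inv_eq_one_div]
    exact one_div_le_one_div_of_le (by norm_num) hpi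
  have hpdf : ∀ z, gaussianPDFReal 0 1 z = (√(2 * π))⁻¹ * Real.exp (-z ^ 2 / 2) := by
    intro z; simp [gaussianPDFReal]
  have key : ∫ z, gaussianPDFReal 0 1 z • f z ≤ ∫ z, ((Set.Ioo (t - w) (t + w)).indicator
      (fun _ => a) z + b * gaussianPDFReal 0 1 z + c / 2 * Real.exp (-(1 / 4) * z ^ 2)) := by
    apply integral_mono_of_nonneg
    · exact Filter.Eventually.of_forall fun z =>
        mul_nonneg (gaussianPDFReal_nonneg _ _ _) (hf0 z)
    · exact (hI1.add hI2).add hI3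
    · refine Filter.Eventually.of_forall fun z => ?_
      have hp0 := gaussianPDFReal_nonneg 0 1 z
      have hp1 : gaussianPDFReal 0 1 z ≤ 1 := by
        rw [hpdf]
        have : Real.exp (-z ^ 2 / 2) ≤ 1 := Real.exp_le_one_iff.2 (by nlinarith [sq_nonneg z])
        have h0 := Real.exp_pos (-z ^ 2 / 2)
        nlinarith
      have hp2 : gaussianPDFReal 0 1 z * Real.exp (z ^ 2 / 4)
          ≤ 1 / 2 * Real.exp (-(1 / 4) * z ^ 2) := by
        rw [hpdf, mul_assoc, ← Real.exp_add]
        have : -z ^ 2 / 2 + z ^ 2 / 4 = -(1 / 4) * z ^ 2 := by ring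
        rw [this]
        exact mul_le_mul_of_nonneg_right hinv (Real.exp_pos _).le
      have hi : 0 ≤ (Set.Ioo (t - w) (t + w)).indicator (fun _ => a) z :=
        Set.indicator_nonneg (fun _ _ => ha) z
      have h1 := mul_le_mul_of_nonneg_left (hf z) hp0
      simp only [smul_eq_mul]
      nlinarith
  refine key.trans ?_
  have hI12 : Integrable (fun z => (Set.Ioo (t - w) (t + w)).indicator (fun _ : ℝ => a) z
      + b * gaussianPDFReal 0 1 z) := hI1.add hI2
  rw [integral_add hI12 hI3, integral_add hI1 hI2, integral_const_mul, integral_const_mul,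
    integral_gaussianPDFReal_eq_one 0 (by norm_num), integral_gaussian,
    integral_indicator measurableSet_Ioo]
  have h4 : √(π / (1 / 4)) ≤ 4 := by
    rw [Real.sqrt_le_left (by norm_num)]
    have := Real.pi_lt_four
    linarith
  have h5 : ∫ _ in Set.Ioo (t - w) (t + w), a = 2 * w * a := by
    simp only [integral_const, smul_eq_mul, Measure.real, Measure.restrict_apply_univ,
      Real.volume_Ioo]
    rw [ENNReal.toReal_ofReal (by linarith)]
    ring
  rw [h5]
  nlinarith

/-- Polynomials for thresholds far from the origin. -/
lemma far_case (k : ℕ) (hk : 4 ≤ k) (t : ℝ) (ht : 1 ≤ |t|) :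
    ∃ pd pu : Polynomial ℝ,
      pd.natDegree ≤ k ∧ pu.natDegree ≤ k ∧
      (∀ n, |pd.coeff n| ≤ 2 ^ (10 * k)) ∧ (∀ n, |pu.coeff n| ≤ 2 ^ (10 * k)) ∧
      (∀ z : ℝ, pd.eval z ≤ (if z ≤ t then 1 else 0) ∧
        (if z ≤ t then (1:ℝ) else 0) ≤ pu.eval z) ∧
      (∫ z, (pu.eval z - pd.eval z) ^ 2 ∂(gaussianReal 0 1)) ≤ 128 / t ^ 4 := by
  have ht2 : 1 ≤ t ^ 2 := by rw [← sq_abs]; nlinarith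
  have ht0 : 0 < t ^ 2 := by linarith
  set Q : Polynomial ℝ := Polynomial.C (1 / t ^ 2) * Polynomial.X ^ 2 with hQ
  have hQe : ∀ z, Q.eval z = z ^ 2 / t ^ 2 := by intro z; simp [hQ]; ring
  have hQd : Q.natDegree ≤ 2 := Polynomial.natDegree_C_mul_X_pow_le _ _
  have hQL : sandL Q ≤ 1 := by
    have h := sandL_X_pow_mul 2 1
    rw [mul_one, sandL_one] at h
    rw [hQ, sandL_C_mul, h, abs_of_pos (by positivity), mul_one, div_le_one ht0]
    exact ht2
  have hbig : (2 : ℝ) ≤ 2 ^ (10 * k) := by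
    calc (2 : ℝ) = 2 ^ 1 := by norm_num
      _ ≤ 2 ^ (10 * k) := pow_le_pow_right₀ (by norm_num) (by omega)
  have hint : ∫ z, (Q.eval z) ^ 2 ∂(gaussianReal 0 1) ≤ 128 / t ^ 4 := by
    have := gauss_bound (fun z => (Q.eval z) ^ 2) 0 0 0 0 (64 / t ^ 4) le_rfl le_rfl
      (by positivity) (fun z => sq_nonneg _) (by
        intro z
        rw [hQe]
        have h1 := Real.add_one_le_exp (z ^ 2 / 8)
        have h2 : Real.exp (z ^ 2 / 4) = Real.exp (z ^ 2 / 8) * Real.exp (z ^ 2 / 8) := by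
          rw [← Real.exp_add]; ring_nf
        have h3 : (z ^ 2 / 8) * (z ^ 2 / 8) ≤ Real.exp (z ^ 2 / 4) := by
          rw [h2]
          exact mul_self_le_mul_self (by positivity) (by linarith)
        have h4 : (z ^ 2 / t ^ 2) ^ 2 = 64 / t ^ 4 * ((z ^ 2 / 8) * (z ^ 2 / 8)) := by
          have : t ≠ 0 := by rintro rfl; norm_num at ht0
          field_simp
          norm_num
        rw [h4]
        simp only [Set.indicator_zero, zero_add, add_zero]
        exact mul_le_mul_of_nonneg_left h3 (by positivity))
    calc _ ≤ _ := this
      _ = 128 / t ^ 4 := by ring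
  rcases le_total t 0 with hneg | hpos
  · refine ⟨0, Q, by simp, by omega, by simp, ?_, ?_, ?_⟩
    · intro n
      linarith [coeff_le_sandL Q n]
    · intro z
      rw [hQe]
      have h0 : 0 ≤ z ^ 2 / t ^ 2 := by positivity
      split_ifs with h
      · refine ⟨by simp, ?_⟩
        rw [le_div_iff₀ ht0]
        nlinarith
      · exact ⟨by simp, h0⟩
    · simpa using hint
  · refine ⟨1 - Q, 1, ?_, by simp, ?_, ?_, ?_, ?_⟩
    · refine (Polynomial.natDegree_sub_le _ _).trans ?_
      simp only [Polynomial.natDegree_one]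
      omega
    · intro n
      have h1 := sandL_sub 1 Q
      rw [sandL_one] at h1
      linarith [coeff_le_sandL (1 - Q) n]
    · intro n
      have h1 := coeff_le_sandL 1 n
      rw [sandL_one] at h1
      linarith
    · intro z
      rw [Polynomial.eval_sub, hQe, Polynomial.eval_one]
      have h0 : 0 ≤ z ^ 2 / t ^ 2 := by positivity
      split_ifs with h
      · exact ⟨by linarith, le_rfl⟩
      · refine ⟨?_, zero_le_one⟩
        push Not at h
        have : 1 ≤ z ^ 2 / t ^ 2 := by
          rw [le_div_iff₀ ht0]
          nlinarith
        linarith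
    · simpa using hint

lemma log_bound (k : ℕ) (hk : 100 ≤ k) : Real.log ((k : ℝ) + 2) ≤ k / 16 := by
  have hk' : (100 : ℝ) ≤ k := by exact_mod_cast hk
  have h1 := Real.log_le_sub_one_of_pos (x := ((k : ℝ) + 2) / 64) (by positivity)
  rw [Real.log_div (by positivity) (by norm_num)] at h1
  have h2 : Real.log 64 = 6 * Real.log 2 := by
    rw [show (64 : ℝ) = 2 ^ 6 by norm_num, Real.log_pow]; norm_num
  have h3 := Real.log_two_lt_d9
  linarith

lemma one_le_log (k : ℕ) (hk : 4 ≤ k) : 1 ≤ Real.log ((k : ℝ) + 2) := by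
  have hk' : (4 : ℝ) ≤ k := by exact_mod_cast hk
  rw [Real.le_log_iff_exp_le (by positivity)]
  have := Real.exp_one_lt_d9
  linarith

set_option maxHeartbeats 1000000 in
/-- Polynomials for thresholds near the origin, large degree. -/
lemma near_case (k : ℕ) (hk : 100 ≤ k) (t : ℝ) (ht : |t| ≤ 4 * √k) :
    ∃ pd pu : Polynomial ℝ,
      pd.natDegree ≤ k ∧ pu.natDegree ≤ k ∧
      (∀ n, |pd.coeff n| ≤ 2 ^ (10 * k)) ∧ (∀ n, |pu.coeff n| ≤ 2 ^ (10 * k)) ∧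
      (∀ z : ℝ, pd.eval z ≤ (if z ≤ t then 1 else 0) ∧
        (if z ≤ t then (1:ℝ) else 0) ≤ pu.eval z) ∧
      (∫ z, (pu.eval z - pd.eval z) ^ 2 ∂(gaussianReal 0 1))
        ≤ 5000 * Real.log ((k : ℝ) + 2) / √k := by
  have hk' : (100 : ℝ) ≤ k := by exact_mod_cast hk
  have hk0 : (0 : ℝ) < k := by linarith
  set L := Real.log ((k : ℝ) + 2) with hL
  have hL1 : 1 ≤ L := one_le_log k (by omega)
  have hL2 : L ≤ k / 16 := log_bound k hk
  set n := (k - 2) / 4 with hn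
  have hn1 : 4 * n + 2 ≤ k := by omega
  have hn2 : k ≤ 8 * n := by omega
  have hn1' : 4 * (n : ℝ) + 2 ≤ k := by exact_mod_cast hn1
  have hn2' : (k : ℝ) ≤ 8 * n := by exact_mod_cast hn2
  have hn0 : (0 : ℝ) < n := by linarith
  set d := L / n with hd
  have hd0 : 0 < d := by positivity
  have hd1 : d ≤ 1 / 2 := by
    rw [hd, div_le_iff₀ hn0]; linarith
  have hnd : n * d = L := by rw [hd]; field_simp
  have hdk : d * k ≤ 8 * L := by
    have : d * k ≤ d * (8 * n) := mul_le_mul_of_nonneg_left hn2' hd0.le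
    nlinarith
  have hdk2 : 4 ≤ d * k := by
    have : d * (4 * n) ≤ d * k := mul_le_mul_of_nonneg_left (by linarith) hd0.le
    nlinarith
  have hexp : Real.exp (2 * (n * d)) = ((k : ℝ) + 2) ^ 2 := by
    rw [hnd, two_mul, Real.exp_add, hL, Real.exp_log (by positivity)]; ring
  have hM0 : (k : ℝ) / 4 ≤ d * Real.exp (2 * (n * d)) / 16 := by
    rw [hexp]
    have : d * k * k ≤ d * (k + 2) ^ 2 := by nlinarith
    nlinarith
  obtain ⟨P, hPd, hPL, hP0, hP1, hPa, hPb, hPc⟩ := exists_step n d hd0 hd1 (by linarith)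
  set M := d * Real.exp (2 * (n * d)) / 16 with hM
  have hM1 : 25 ≤ M := by linarith
  set s := √(k : ℝ) with hs
  have hs2 : s ^ 2 = k := Real.sq_sqrt hk0.le
  have hs10 : 10 ≤ s := Real.le_sqrt_of_sq_le (by linarith)
  set R := 8 * s with hR
  have hR0 : 0 < R := by linarith
  -- the affine substitution
  set r : Polynomial ℝ := Polynomial.C (1 / R) * (Polynomial.X - Polynomial.C t) with hr
  have hre : ∀ z, r.eval z = (z - t) / R := by intro z; simp [hr]; ring
  have hrd : r.natDegree ≤ 1 := by
    refine (Polynomial.natDegree_C_mul_le _ _).trans ?_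
    simp
  have hrL : sandL r ≤ 1 := by
    rw [hr, sandL_C_mul, abs_of_pos (by positivity)]
    have := sandL_sub Polynomial.X (Polynomial.C t)
    rw [sandL_X, sandL_C] at this
    rw [div_mul_eq_mul_div, one_mul, div_le_one hR0]
    linarith
  have hB : (4 : ℝ) * 49 ^ n ≤ Real.exp 1 ^ k := by
    have he := Real.exp_one_gt_d9
    have e0 : (2.7182818283 : ℝ) ≤ Real.exp 1 := he.le
    have e1 : (4 : ℝ) ≤ Real.exp 1 ^ 2 := by
      refine le_trans (by norm_num) (pow_le_pow_left₀ (by norm_num) e0 2)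
    have e2 : (49 : ℝ) ≤ Real.exp 1 ^ 4 := by
      refine le_trans (by norm_num) (pow_le_pow_left₀ (by norm_num) e0 4)
    calc (4 : ℝ) * 49 ^ n ≤ Real.exp 1 ^ 2 * (Real.exp 1 ^ 4) ^ n := by gcongr
      _ = Real.exp 1 ^ (4 * n + 2) := by rw [← pow_mul, ← pow_add]; ring_nf
      _ ≤ Real.exp 1 ^ k := pow_le_pow_right₀ (by linarith) hn1
  have hB1 : (1 : ℝ) ≤ Real.exp 1 ^ k := one_le_pow₀ (by linarith [Real.exp_one_gt_d9])
  have hB2 : 1 + Real.exp 1 ^ k ≤ 2 ^ (10 * k) := by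
    have e1 : Real.exp 1 ^ k ≤ 4 ^ k :=
      pow_le_pow_left₀ (Real.exp_pos _).le (by linarith [Real.exp_one_lt_d9]) k
    have e2 : (1 : ℝ) ≤ 4 ^ k := one_le_pow₀ (by norm_num)
    calc 1 + Real.exp 1 ^ k ≤ 2 * 4 ^ k := by linarith
      _ ≤ 2 ^ k * 4 ^ k := by
        gcongr
        exact le_self_pow₀ (by norm_num) (by omega)
      _ = 2 ^ (3 * k) := by rw [← mul_pow, pow_mul]; norm_num
      _ ≤ 2 ^ (10 * k) := pow_le_pow_right₀ (by norm_num) (by omega)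
  have hPk : P.natDegree ≤ k := hPd.trans hn1
  have hcd : ∀ r : Polynomial ℝ, r.natDegree ≤ 1 → (P.comp r).natDegree ≤ k := by
    intro r hr
    rw [Polynomial.natDegree_comp]
    nlinarith
  have hcu : sandL (P.comp r) ≤ Real.exp 1 ^ k := (sandL_comp _ _ hrL).trans (hPL.trans hB)
  have hcl : sandL (P.comp (-r)) ≤ Real.exp 1 ^ k :=
    (sandL_comp _ _ (by rw [sandL_neg]; exact hrL)).trans (hPL.trans hB)
  have hue : ∀ z, (P.comp r).eval z = P.eval ((z - t) / R) := by
    intro z; rw [Polynomial.eval_comp, hre]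
  have hle : ∀ z, (1 - P.comp (-r)).eval z = 1 - P.eval (-((z - t) / R)) := by
    intro z; rw [Polynomial.eval_sub, Polynomial.eval_comp, Polynomial.eval_neg, hre]; simp
  refine ⟨1 - P.comp (-r), P.comp r, ?_, hcd r hrd, ?_, ?_, ?_, ?_⟩
  · refine (Polynomial.natDegree_sub_le _ _).trans ?_
    simp only [Polynomial.natDegree_one]
    have := hcd (-r) (by rw [Polynomial.natDegree_neg]; exact hrd)
    omega
  · intro m
    have h1 := sandL_sub 1 (P.comp (-r))
    rw [sandL_one] at h1
    linarith [coeff_le_sandL (1 - P.comp (-r)) m]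
  · intro m
    linarith [coeff_le_sandL (P.comp r) m]
  · intro z
    rw [hue, hle]
    split_ifs with h
    · refine ⟨by linarith [hP0 (-((z - t) / R))], hP1 _ ?_⟩
      exact div_nonpos_of_nonpos_of_nonneg (by linarith) hR0.le
    · refine ⟨?_, hP0 _⟩
      push Not at h
      have : 0 ≤ (z - t) / R := div_nonneg (by linarith) hR0.le
      linarith [hP1 (-((z - t) / R)) (by linarith)]
  · -- the integral
    have hD : ∀ x, 0 ≤ P.eval x + P.eval (-x) - 1 := by
      intro x
      rcases le_total x 0 with h | h
      · linarith [hP1 x h, hP0 (-x)]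
      · linarith [hP1 (-x) (by linarith), hP0 x]
    have hM2 : 2 / M ≤ 1 := by rw [div_le_one (by linarith)]; linarith
    -- middle
    have hmid : ∀ x, 0 ≤ x → x ≤ 1 → P.eval x + P.eval (-x) - 1 ≤ 2 := by
      intro x h1 h2
      linarith [hPb x h1 h2, hPa (-x) (by linarith) (by linarith)]
    have hside : ∀ x, 2 * d ≤ x → x ≤ 1 → P.eval x + P.eval (-x) - 1 ≤ 3 / M := by
      intro x h1 h2
      have e : 3 / M = 1 / M + 2 / M := by ring
      linarith [hPc x h1 h2, hPa (-x) (by linarith) (by linarith)]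
    have hsym : ∀ x, P.eval x + P.eval (-x) - 1 = P.eval |x| + P.eval (-|x|) - 1 := by
      intro x
      rcases abs_choice x with h | h
      · rw [h]
      · rw [h, neg_neg]; ring
    have hout : ∀ x, 1 ≤ |x| → P.eval x + P.eval (-x) - 1 ≤ 2 * Real.exp (k * |x|) := by
      intro x hx
      have h1 := eval_le_sandL P k hPk x hx
      have h2 := eval_le_sandL P k hPk (-x) (by rwa [abs_neg])
      rw [abs_neg] at h2
      have h3 : sandL P * |x| ^ k ≤ Real.exp (k * |x|) := by
        have e1 : Real.exp (k * |x|) = Real.exp 1 ^ k * Real.exp (|x| - 1) ^ k := by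
          rw [← mul_pow, ← Real.exp_add, ← Real.exp_nat_mul]; ring_nf
        rw [e1]
        have e2 : |x| ≤ Real.exp (|x| - 1) := by linarith [Real.add_one_le_exp (|x| - 1)]
        exact mul_le_mul (hPL.trans hB) (pow_le_pow_left₀ (abs_nonneg _) e2 k) (by positivity)
          (by positivity)
      linarith [le_abs_self (P.eval x), le_abs_self (P.eval (-x))]
    have hbd := gauss_bound (fun z => ((P.comp r).eval z - (1 - P.comp (-r)).eval z) ^ 2) t
      (2 * d * R) 4 (9 / M ^ 2) (4 * Real.exp (-2 * k)) (by norm_num) (by positivity)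
      (by positivity) (fun z => sq_nonneg _) (by
        intro z
        have e : (P.comp r).eval z - (1 - P.comp (-r)).eval z
          = P.eval ((z - t) / R) + P.eval (-((z - t) / R)) - 1 := by
          rw [hue, hle]; ring
        simp only [e]
        set x := (z - t) / R with hx
        have hz : z = t + R * x := by rw [hx]; field_simp; ring
        have i1 : 0 ≤ (Set.Ioo (t - 2 * d * R) (t + 2 * d * R)).indicator
          (fun _ => (4 : ℝ)) z := Set.indicator_nonneg (fun _ _ => by norm_num) z
        have i2 : 0 ≤ 9 / M ^ 2 := by positivity
        have i3 : 0 ≤ 4 * Real.exp (-2 * k) * Real.exp (z ^ 2 / 4) := by positivity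
        have hDx := hD x
        rcases lt_or_ge |x| (2 * d) with hc | hc
        · have hm : z ∈ Set.Ioo (t - 2 * d * R) (t + 2 * d * R) := by
            rw [abs_lt] at hc
            constructor <;> nlinarith
          rw [Set.indicator_of_mem hm]
          have := hmid |x| (abs_nonneg x) (by linarith)
          rw [← hsym] at this
          nlinarith
        · rcases le_total |x| 1 with hc1 | hc1
          · have := hside |x| hc hc1
            rw [← hsym] at this
            have h2 := pow_le_pow_left₀ hDx this 2
            rw [div_pow] at h2
            norm_num at h2
            linarith
          · have := hout x hc1
            have h2 := pow_le_pow_left₀ hDx this 2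
            have h3 : (2 * Real.exp (k * |x|)) ^ 2 = 4 * Real.exp (2 * k * |x|) := by
              rw [mul_pow, ← Real.exp_nat_mul]; push_cast; ring_nf
            have h4 : Real.exp (2 * k * |x|) ≤ Real.exp (-2 * k) * Real.exp (z ^ 2 / 4) := by
              rw [← Real.exp_add]
              apply Real.exp_le_exp.2
              have j1 : R / 2 * |x| ≤ |z| := by
                have : R * |x| = |z - t| := by
                  rw [hz, add_sub_cancel_left, abs_mul, abs_of_pos hR0]
                have j2 := abs_sub z t
                have j3 : |t| ≤ R / 2 * |x| := by nlinarith
                linarith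
              have j4 : (R / 2 * |x|) ^ 2 ≤ |z| ^ 2 :=
                pow_le_pow_left₀ (by positivity) j1 2
              rw [sq_abs] at j4
              have j5 : (R / 2 * |x|) ^ 2 = 16 * k * |x| ^ 2 := by
                rw [hR, ← hs2]; ring
              have j6 : |x| ≤ |x| ^ 2 := by nlinarith
              have j7 : (k : ℝ) * |x| ≤ k * |x| ^ 2 := mul_le_mul_of_nonneg_left j6 hk0.le
              have j8 : (k : ℝ) * 1 ≤ k * |x| := mul_le_mul_of_nonneg_left hc1 hk0.le
              linarith
            nlinarith)
    refine hbd.trans ?_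
    rw [le_div_iff₀ (by linarith)]
    have hsk : s ≤ k := by rw [← hs2]; exact le_self_pow₀ (by linarith) (by norm_num)
    have f1 : 9 / M ^ 2 * s ≤ 9 := by
      rw [div_mul_eq_mul_div, div_le_iff₀ (by positivity)]
      have g0 : 25 * M ≤ M ^ 2 := by rw [sq]; exact mul_le_mul_of_nonneg_right hM1 (by linarith)
      have : s ≤ M ^ 2 := by linarith
      linarith
    have f2 : Real.exp (-2 * k) * s ≤ 1 := by
      have g1 : Real.exp (-2 * k) * Real.exp (2 * k) = 1 := by
        rw [← Real.exp_add]; simp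
      have g2 := Real.add_one_le_exp (2 * (k : ℝ))
      have g3 : s ≤ Real.exp (2 * k) := by linarith
      calc _ ≤ _ := mul_le_mul_of_nonneg_left g3 (Real.exp_pos _).le
        _ = 1 := g1
    have f3 : d * s * s ≤ 8 * L := by
      have : d * s * s = d * k := by rw [← hs2]; ring
      linarith
    have f4 : (2 * (2 * d * R) * 4 + 9 / M ^ 2 + 2 * (4 * Real.exp (-2 * k))) * s
        = 128 * (d * s * s) + 9 / M ^ 2 * s + 8 * (Real.exp (-2 * k) * s) := by rw [hR]; ring
    rw [f4]
    linarith

/-- `L2` sandwiching polynomials for one-dimensional half-line indicators under `N(0,1)`: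
for every `k ≥ 4` and `t ∈ ℝ` there are degree-`≤ k` polynomials `p_down ≤ 1_{z ≤ t} ≤ p_up`
with coefficients bounded by `2^{10k}` and `E_{N(0,1)}[(p_up - p_down)²] ≤ C·(log(k+2))^{10}/√k`;
moreover, if `|t| ≥ 1` they can be chosen with `E_{N(0,1)}[(p_up - p_down)²] ≤ C/t²` as well. -/
theorem one_dim_sandwiching_L2 :
    ∃ C : ℝ, 1 ≤ C ∧
      ∀ k : ℕ, 4 ≤ k → ∀ t : ℝ,
      ∃ pd pu : Polynomial ℝ,
        pd.natDegree ≤ k ∧ pu.natDegree ≤ k ∧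
        (∀ n, |pd.coeff n| ≤ 2 ^ (10 * k)) ∧ (∀ n, |pu.coeff n| ≤ 2 ^ (10 * k)) ∧
        (∀ z : ℝ, pd.eval z ≤ (if z ≤ t then 1 else 0) ∧
          (if z ≤ t then (1:ℝ) else 0) ≤ pu.eval z) ∧
        (∫ z, (pu.eval z - pd.eval z) ^ 2 ∂(gaussianReal 0 1))
          ≤ C * (Real.log ((k : ℝ) + 2)) ^ 10 / Real.sqrt k ∧
        (1 ≤ |t| →
          (∫ z, (pu.eval z - pd.eval z) ^ 2 ∂(gaussianReal 0 1)) ≤ C / t ^ 2) := by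
  refine ⟨5000, by norm_num, fun k hk t => ?_⟩
  have hk' : (4 : ℝ) ≤ k := by exact_mod_cast hk
  set L := Real.log ((k : ℝ) + 2) with hL
  have hL1 : 1 ≤ L := one_le_log k hk
  have hL10 : 1 ≤ L ^ 10 := one_le_pow₀ hL1
  have hLL : L ≤ L ^ 10 := le_self_pow₀ hL1 (by norm_num)
  set s := √(k : ℝ) with hs
  have hs2 : s ^ 2 = k := Real.sq_sqrt (by linarith)
  have hs1 : 2 ≤ s := Real.le_sqrt_of_sq_le (by linarith)
  have hs0 : 0 < s := by linarith
  by_cases hfar : 1 ≤ |t| ∧ s ≤ t ^ 2 * L ^ 10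
  · obtain ⟨ht, hts⟩ := hfar
    obtain ⟨pd, pu, h1, h2, h3, h4, h5, h6⟩ := far_case k hk t ht
    have ht2 : 1 ≤ t ^ 2 := by rw [← sq_abs]; nlinarith
    have ht4 : t ^ 2 ≤ t ^ 4 := by nlinarith
    refine ⟨pd, pu, h1, h2, h3, h4, h5, h6.trans ?_, fun _ => h6.trans ?_⟩
    · rw [div_le_div_iff₀ (by linarith) hs0]
      nlinarith
    · rw [div_le_div_iff₀ (by linarith) (by linarith)]
      nlinarith
  · have hnear : 1 ≤ |t| → t ^ 2 * L ^ 10 < s := by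
      intro h
      by_contra hc
      exact hfar ⟨h, not_lt.1 hc⟩
    by_cases hk100 : 100 ≤ k
    · have ht : |t| ≤ 4 * s := by
        rcases le_total 1 |t| with h | h
        · have h1 := hnear h
          have h2 : |t| ^ 2 = t ^ 2 := sq_abs t
          nlinarith
        · linarith
      obtain ⟨pd, pu, h1, h2, h3, h4, h5, h6⟩ := near_case k hk100 t ht
      have h7 : 5000 * L / s ≤ 5000 * L ^ 10 / s := by gcongr
      refine ⟨pd, pu, h1, h2, h3, h4, h5, h6.trans h7, fun h => h6.trans (h7.trans ?_)⟩
      have ht2 : 1 ≤ t ^ 2 := by rw [← sq_abs]; nlinarith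
      rw [div_le_div_iff₀ hs0 (by linarith)]
      have := hnear h
      nlinarith
    · have hs10 : s ≤ 10 := by
        have : (k : ℝ) ≤ 100 := by exact_mod_cast (not_le.1 hk100).le
        nlinarith
      have hbig : (1 : ℝ) ≤ 2 ^ (10 * k) := one_le_pow₀ (by norm_num)
      refine ⟨0, 1, by simp, by simp, by simp, ?_, ?_, ?_, ?_⟩
      · intro m
        have h1 := coeff_le_sandL 1 m
        rw [sandL_one] at h1
        linarith
      · intro z
        split_ifs <;> simp
      · simp
        rw [le_div_iff₀ hs0]
        linarith
      · intro h
        have ht2 : 1 ≤ t ^ 2 := by rw [← sq_abs]; nlinarith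
        simp
        rw [le_div_iff₀ (by linarith)]
        have := hnear h
        nlinarith

end
end
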